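/- arXiv:1609.07235 — 5 statements merged into one kernel-verified Lean document; each statement's English description precedes it below -/
import Mathlib

section
/- For every s with 0 < s < 2 and every c with 0 < c < ∞, there exists a compact hereditarily non uniformly perfect set K ⊆ ℂ such that dim_H K = s and H^s(K) = c. -/
open MeasureTheory Filter Metric

/-- A compact set `F` with at least two points is uniformly perfect if there is `c > 0`
such that for every `a ∈ F` and every `r` with `0 < r < diam F` the annulus
`{y : c·r < ‖y − a‖ < r}` meets `F`. -/
def UniformlyPerfect {X : Type*} [NormedAddCommGroup X] (F : Set X) : Prop :=
  IsCompact F ∧ F.Nontrivial ∧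
    ∃ c : ℝ, 0 < c ∧ ∀ a ∈ F, ∀ r : ℝ, 0 < r → r < Metric.diam F →
      ∃ y ∈ F, c * r < ‖y - a‖ ∧ ‖y - a‖ < r

/-- A compact set is hereditarily non uniformly perfect (HNUP) if no (compact) subset
of it is uniformly perfect. -/
def HNUP {X : Type*} [NormedAddCommGroup X] (E : Set X) : Prop :=
  ∀ F : Set X, F ⊆ E → ¬ UniformlyPerfect F

open Topology

abbrev Dig (N : ℕ → ℕ) : Type := (n : ℕ) → Fin (N n)

noncomputable def DS {N : ℕ → ℕ} (d : ℕ → ℝ) (a : Dig N) : ℝ := ∑' n, ((a n : ℕ) : ℝ) * d n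

structure DH (N : ℕ → ℕ) (d L : ℕ → ℝ) : Prop where
  d0 : ∀ n, 0 ≤ d n
  L0 : ∀ n, 0 ≤ L n
  h : ∀ n, ((N n : ℝ) - 1) * d n ≤ L n - L (n+1)

lemma dig_le {N : ℕ → ℕ} (a : Dig N) (n : ℕ) : ((a n : ℕ) : ℝ) ≤ (N n : ℝ) - 1 := by
  have := (a n).2
  have h2 : ((a n : ℕ) : ℝ) + 1 ≤ N n := by exact_mod_cast this
  linarith

lemma DH.term_le {N : ℕ → ℕ} {d L : ℕ → ℝ} (H : DH N d L) (a : Dig N) (n : ℕ) :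
    ((a n : ℕ) : ℝ) * d n ≤ L n - L (n+1) :=
  (mul_le_mul_of_nonneg_right (dig_le a n) (H.d0 n)).trans (H.h n)

lemma DH.term_nonneg {N : ℕ → ℕ} {d L : ℕ → ℝ} (H : DH N d L) (a : Dig N) (n : ℕ) :
    0 ≤ ((a n : ℕ) : ℝ) * d n := mul_nonneg (Nat.cast_nonneg _) (H.d0 n)

lemma DH.partial_le {N : ℕ → ℕ} {d L : ℕ → ℝ} (H : DH N d L) (a : Dig N) (n m : ℕ) :
    ∑ k ∈ Finset.range m, ((a (k+n) : ℕ) : ℝ) * d (k+n) ≤ L n := by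
  have : ∑ k ∈ Finset.range m, ((a (k+n) : ℕ) : ℝ) * d (k+n) ≤ L n - L (m + n) := by
    induction m with
    | zero => simp
    | succ m ih =>
      rw [Finset.sum_range_succ]
      have := H.term_le a (m+n)
      have e : m + 1 + n = m + n + 1 := by ring
      rw [e]; linarith
  linarith [H.L0 (m+n)]

lemma DH.summable {N : ℕ → ℕ} {d L : ℕ → ℝ} (H : DH N d L) (a : Dig N) :
    Summable (fun n => ((a n : ℕ) : ℝ) * d n) :=
  summable_of_sum_range_le (H.term_nonneg a) (fun m => H.partial_le a 0 m)

lemma DH.tail {N : ℕ → ℕ} {d L : ℕ → ℝ} (H : DH N d L) (a : Dig N) (n : ℕ) :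
    ∃ t, 0 ≤ t ∧ t ≤ L n ∧ DS d a = ∑ k ∈ Finset.range n, ((a k : ℕ) : ℝ) * d k + t := by
  refine ⟨∑' k, ((a (k+n) : ℕ) : ℝ) * d (k+n), tsum_nonneg fun k => H.term_nonneg a _, ?_, ?_⟩
  · exact Real.tsum_le_of_sum_range_le (fun k => H.term_nonneg a _) (fun m => H.partial_le a n m)
  · exact ((H.summable a).sum_add_tsum_nat_add n).symm

lemma DH.agree {N : ℕ → ℕ} {d L : ℕ → ℝ} (H : DH N d L) {a b : Dig N} {n : ℕ}
    (hab : ∀ k < n, a k = b k) : |DS d a - DS d b| ≤ L n := by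
  obtain ⟨t, ht0, ht1, ht⟩ := H.tail a n
  obtain ⟨u, hu0, hu1, hu⟩ := H.tail b n
  have : ∑ k ∈ Finset.range n, ((a k : ℕ) : ℝ) * d k
      = ∑ k ∈ Finset.range n, ((b k : ℕ) : ℝ) * d k :=
    Finset.sum_congr rfl fun k hk => by rw [hab k (Finset.mem_range.1 hk)]
  rw [ht, hu, this, abs_le]; constructor <;> linarith

lemma DH.differ {N : ℕ → ℕ} {d L : ℕ → ℝ} (H : DH N d L) {a b : Dig N} {n : ℕ}
    (hab : ∀ k < n, a k = b k) :
    |DS d a - DS d b - (((a n : ℕ) : ℝ) - ((b n : ℕ) : ℝ)) * d n| ≤ L (n+1) := by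
  obtain ⟨t, ht0, ht1, ht⟩ := H.tail a (n+1)
  obtain ⟨u, hu0, hu1, hu⟩ := H.tail b (n+1)
  have : ∑ k ∈ Finset.range n, ((a k : ℕ) : ℝ) * d k
      = ∑ k ∈ Finset.range n, ((b k : ℕ) : ℝ) * d k :=
    Finset.sum_congr rfl fun k hk => by rw [hab k (Finset.mem_range.1 hk)]
  rw [Finset.sum_range_succ] at ht hu
  rw [ht, hu, this, abs_le]; constructor <;> linarith

lemma DH.continuous {N : ℕ → ℕ} {d L : ℕ → ℝ} (H : DH N d L) :
    Continuous (DS d : Dig N → ℝ) := by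
  by_cases hne : Nonempty (Dig N)
  swap
  · have : IsEmpty (Dig N) := not_nonempty_iff.1 hne
    exact continuous_of_discreteTopology
  have hN : ∀ n, 1 ≤ N n := fun n => by
    have := (hne.some n).2; omega
  let top : Dig N := fun n => ⟨N n - 1, by have := hN n; omega⟩
  refine continuous_tsum (u := fun n => ((top n : ℕ) : ℝ) * d n) (fun n => ?_) (H.summable top) ?_
  · have : Continuous (fun x : Fin (N n) => ((x : ℕ) : ℝ)) := continuous_of_discreteTopology
    exact (this.comp (continuous_apply n)).mul continuous_const
  · intro n a
    rw [Real.norm_of_nonneg (H.term_nonneg a n)]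
    refine mul_le_mul_of_nonneg_right ?_ (H.d0 n)
    have : (a n : ℕ) ≤ N n - 1 := by have := (a n).2; omega
    exact_mod_cast this

lemma first_diff {N : ℕ → ℕ} {a b : Dig N} (h : a ≠ b) :
    ∃ n, (∀ k < n, a k = b k) ∧ a n ≠ b n := by
  classical
  have : ∃ n, a n ≠ b n := Function.ne_iff.1 h
  exact ⟨Nat.find this, fun k hk => not_not.1 (Nat.find_min this hk), Nat.find_spec this⟩

/-- gap property -/
def GapP (K : Set ℂ) : Prop :=
  ∀ c > 0, ∀ R > 0, ∃ r, 0 < r ∧ r < R ∧ ∀ a ∈ K, ∀ b ∈ K, ‖a - b‖ ≤ c * r ∨ r ≤ ‖a - b‖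

lemma GapP.hnup {K : Set ℂ} (h : GapP K) : HNUP K := by
  rintro F hF ⟨hc, hn, c, hc0, hU⟩
  have hd : 0 < Metric.diam F := Metric.diam_pos hn hc.isBounded
  obtain ⟨r, hr0, hrR, hr⟩ := h c hc0 _ hd
  obtain ⟨a, ha⟩ := hn.nonempty
  obtain ⟨y, hy, h1, h2⟩ := hU a ha r hr0 hrR
  rcases hr y (hF hy) a (hF ha) with h | h <;> linarith

open Pointwise in
lemma GapP.smul {K : Set ℂ} (h : GapP K) {t : ℝ} (ht : 0 < t) : GapP (t • K) := by
  intro c hc R hR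
  obtain ⟨r, hr0, hrR, hr⟩ := h c hc (R / t) (by positivity)
  refine ⟨t * r, by positivity, by rw [lt_div_iff₀ ht] at hrR; linarith, ?_⟩
  rintro _ ⟨a, ha, rfl⟩ _ ⟨b, hb, rfl⟩
  have : ‖t • a - t • b‖ = t * ‖a - b‖ := by
    rw [← smul_sub, norm_smul, Real.norm_of_nonneg ht.le]
  simp only [this]
  rcases hr a ha b hb with h | h
  · left; nlinarith
  · right; nlinarith

open Pointwise in
lemma finish (s c : ℝ) (hs0 : 0 < s) (hc : 0 < c) (K : Set ℂ) (hK : IsCompact K) (hg : GapP K)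
    (h0 : μH[s] K ≠ 0) (h1 : μH[s] K ≠ ⊤) :
    ∃ K : Set ℂ, IsCompact K ∧ HNUP K ∧
      dimH K = ENNReal.ofReal s ∧ μH[s] K = ENNReal.ofReal c := by
  set m := (μH[s] K).toReal with hm
  have hm0 : 0 < m := ENNReal.toReal_pos h0 h1
  have hmE : μH[s] K = ENNReal.ofReal m := (ENNReal.ofReal_toReal h1).symm
  set t : ℝ := (c / m) ^ (1/s) with ht
  have ht0 : 0 < t := by positivity
  have hts : t ^ s = c / m := by
    rw [ht, ← Real.rpow_mul (by positivity)]; simp [hs0.ne']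
  have hmeas : μH[s] (t • K) = ENNReal.ofReal c := by
    rw [Measure.hausdorffMeasure_smul₀ hs0.le ht0.ne', hmE]
    have : ‖t‖₊ ^ s = Real.toNNReal (c / m) := by
      rw [← hts]; ext
      rw [Real.coe_toNNReal _ (by positivity)]; simp [abs_of_pos ht0]
    rw [this, ENNReal.smul_def, smul_eq_mul]
    change ENNReal.ofReal (c/m) * _ = _
    rw [← ENNReal.ofReal_mul (by positivity)]
    congr 1; field_simp
  refine ⟨t • K, hK.smul t, (hg.smul ht0).hnup, ?_, hmeas⟩
  have := dimH_of_hausdorffMeasure_ne_zero_ne_top (d := s.toNNReal) (s := t • K)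
    (by rw [Real.coe_toNNReal _ hs0.le, hmeas]; simpa using hc)
    (by rw [Real.coe_toNNReal _ hs0.le, hmeas]; simp)
  exact this

/-- parameters -/
structure Par (N : ℕ → ℕ) (p : ℝ) : Prop where
  p1 : 1 < p
  N2 : ∀ n, 2 ≤ N n
  Np : ∀ n, 2 ≤ (N n : ℝ) ^ (p - 1)
  lim : Tendsto (fun n => (N n : ℝ) ^ (p - 1)) atTop atTop

lemma exists_par {p : ℝ} (hp : 1 < p) : ∃ N, Par N p := by
  have h : Tendsto (fun n : ℕ => (n : ℝ) ^ (p - 1)) atTop atTop :=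
    (tendsto_rpow_atTop (by linarith)).comp tendsto_natCast_atTop_atTop
  obtain ⟨M, hM⟩ := eventually_atTop.1 (h.eventually_ge_atTop 2)
  refine ⟨fun n => n + (M + 2), hp, fun n => by omega, fun n => hM _ (by omega), ?_⟩
  exact h.comp (tendsto_add_atTop_nat (M+2))

noncomputable def PP (N : ℕ → ℕ) (n : ℕ) : ℝ := ∏ k ∈ Finset.range n, (N k : ℝ)

lemma PP_succ (N : ℕ → ℕ) (n : ℕ) : PP N (n+1) = PP N n * N n := Finset.prod_range_succ _ _

namespace Par
variable {N : ℕ → ℕ} {p : ℝ}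

lemma Npos (H : Par N p) (n : ℕ) : (0:ℝ) < N n := by
  have := H.N2 n
  exact_mod_cast (by omega : 0 < N n)

lemma N1 (H : Par N p) (n : ℕ) : (1:ℝ) ≤ N n := by
  have := H.N2 n
  exact_mod_cast (by omega : 1 ≤ N n)

lemma Ppos (H : Par N p) (n : ℕ) : 0 < PP N n := Finset.prod_pos fun k _ => H.Npos k

lemma Pge (H : Par N p) (n : ℕ) : (2:ℝ)^n ≤ PP N n := by
  induction n with
  | zero => simp [PP]
  | succ n ih =>
    rw [PP_succ, pow_succ]
    have : (2:ℝ) ≤ N n := by exact_mod_cast H.N2 n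
    exact mul_le_mul ih this (by norm_num) (H.Ppos n).le

lemma Ptend (H : Par N p) : Tendsto (PP N) atTop atTop :=
  tendsto_atTop_mono H.Pge (tendsto_pow_atTop_atTop_of_one_lt (by norm_num))

end Par

noncomputable def LL (N : ℕ → ℕ) (p : ℝ) (n : ℕ) : ℝ := PP N n ^ (-p)
noncomputable def dd (N : ℕ → ℕ) (p : ℝ) (n : ℕ) : ℝ := LL N p n / N n
noncomputable def LL' (N : ℕ → ℕ) (n : ℕ) : ℝ := (PP N n)⁻¹
noncomputable def dd' (N : ℕ → ℕ) (n : ℕ) : ℝ := (PP N (n+1))⁻¹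

namespace Par
variable {N : ℕ → ℕ} {p : ℝ}

lemma Lpos (H : Par N p) (n : ℕ) : 0 < LL N p n := Real.rpow_pos_of_pos (H.Ppos n) _
lemma dpos (H : Par N p) (n : ℕ) : 0 < dd N p n := div_pos (H.Lpos n) (H.Npos n)

lemma Lsucc (H : Par N p) (n : ℕ) : LL N p (n+1) * (N n : ℝ)^(p-1) = dd N p n := by
  unfold dd LL
  rw [PP_succ, Real.mul_rpow (H.Ppos n).le (H.Npos n).le, mul_assoc,
    ← Real.rpow_add (H.Npos n)]
  have : -p + (p - 1) = -1 := by ring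
  rw [this, Real.rpow_neg_one]; rfl

lemma Lhalf (H : Par N p) (n : ℕ) : LL N p (n+1) ≤ dd N p n / 2 := by
  rw [← H.Lsucc n]
  nlinarith [H.Lpos (n+1), H.Np n]

lemma d_le (H : Par N p) (n : ℕ) : dd N p n ≤ LL N p n :=
  div_le_self (H.Lpos n).le (H.N1 n)

lemma DH1 (H : Par N p) : DH N (dd N p) (LL N p) where
  d0 n := (H.dpos n).le
  L0 n := (H.Lpos n).le
  h n := by
    have : (N n : ℝ) * dd N p n = LL N p n := by
      unfold dd; field_simp [(H.Npos n).ne']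
    have h2 := H.Lhalf n
    have := H.dpos n
    linarith

lemma DH2 (H : Par N p) : DH N (dd' N) (LL' N) where
  d0 n := (inv_pos.2 (H.Ppos _)).le
  L0 n := (inv_pos.2 (H.Ppos _)).le
  h n := by
    have h1 := H.Ppos n
    have h2 := H.Npos n
    unfold LL' dd'; rw [PP_succ]
    apply le_of_eq; field_simp

lemma Ltend (H : Par N p) : Tendsto (LL N p) atTop (𝓝 0) :=
  (tendsto_rpow_neg_atTop (by linarith [H.p1])).comp H.Ptend

lemma d_anti (H : Par N p) : Antitone (dd N p) :=
  antitone_nat_of_succ_le fun n => by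
    linarith [H.d_le (n+1), H.Lhalf n, H.dpos n]

/-- lower bound at the first difference -/
lemma lower (H : Par N p) {a b : Dig N} {n : ℕ} (hab : ∀ k < n, a k = b k) (hn : a n ≠ b n) :
    1 ≤ |((a n : ℕ) : ℝ) - ((b n : ℕ) : ℝ)| ∧
    |((a n : ℕ) : ℝ) - ((b n : ℕ) : ℝ)| * dd N p n / 2 ≤ |DS (dd N p) a - DS (dd N p) b| := by
  have h1 : 1 ≤ |((a n : ℕ) : ℝ) - ((b n : ℕ) : ℝ)| := by
    have : ((a n : ℕ) : ℤ) - ((b n : ℕ) : ℤ) ≠ 0 := by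
      intro h; apply hn; ext; omega
    have := Int.one_le_abs this
    exact_mod_cast this
  refine ⟨h1, ?_⟩
  have h2 := H.DH1.differ hab
  have h3 := H.Lhalf n
  have h4 := H.dpos n
  have h5 : |(((a n : ℕ) : ℝ) - ((b n : ℕ) : ℝ)) * dd N p n| =
     |((a n : ℕ) : ℝ) - ((b n : ℕ) : ℝ)| * dd N p n := by rw [abs_mul, abs_of_pos h4]
  have h6 := abs_sub_abs_le_abs_sub ((((a n : ℕ) : ℝ) - ((b n : ℕ) : ℝ)) * dd N p n)
    (DS (dd N p) a - DS (dd N p) b)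
  rw [abs_sub_comm] at h2
  nlinarith

lemma gap (H : Par N p) (a b : Dig N) (n : ℕ) :
    |DS (dd N p) a - DS (dd N p) b| ≤ LL N p (n+1) ∨
    dd N p n / 2 ≤ |DS (dd N p) a - DS (dd N p) b| := by
  by_cases h : ∀ k < n + 1, a k = b k
  · exact .inl (H.DH1.agree h)
  · right
    have hne : a ≠ b := fun e => h fun k _ => by rw [e]
    obtain ⟨m, hm, hm'⟩ := first_diff hne
    have hmn : m ≤ n := by
      by_contra hc
      exact h fun k hk => hm k (by omega)
    obtain ⟨h1, h2⟩ := H.lower hm hm'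
    have := H.d_anti hmn
    nlinarith [H.dpos m]

lemma holder (H : Par N p) (a b : Dig N) :
    |DS (dd' N) a - DS (dd' N) b| ≤
      (2^(p+1) * |DS (dd N p) a - DS (dd N p) b|) ^ (1/p) := by
  have hp0 : 0 < p := by linarith [H.p1]
  by_cases h : a = b
  · subst h; simp [hp0.ne']
  obtain ⟨n, hn, hn'⟩ := first_diff h
  obtain ⟨h1, h2⟩ := H.lower hn hn'
  have h3 := H.DH2.differ hn
  have hP := H.Ppos n
  have hN := H.Npos n
  set k := |((a n : ℕ) : ℝ) - ((b n : ℕ) : ℝ)| with hk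
  have hkN : k ≤ N n := by
    rw [hk, abs_le]
    have := dig_le a n
    have := dig_le b n
    have : (0:ℝ) ≤ ((a n : ℕ) : ℝ) := Nat.cast_nonneg _
    have : (0:ℝ) ≤ ((b n : ℕ) : ℝ) := Nat.cast_nonneg _
    constructor <;> linarith
  set u := k / N n with hu
  have hu0 : 0 < u := by positivity
  have hu1 : u ≤ 1 := (div_le_one hN).2 hkN
  have h4 : |DS (dd' N) a - DS (dd' N) b| ≤ 2 * u * (PP N n)⁻¹ := by
    have hd : dd' N n = (PP N n)⁻¹ * (N n : ℝ)⁻¹ := by unfold dd'; rw [PP_succ, mul_inv]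
    have hL : LL' N (n+1) = dd' N n := rfl
    have h5 : |(((a n : ℕ) : ℝ) - ((b n : ℕ) : ℝ)) * dd' N n| = k * dd' N n := by
      rw [abs_mul, abs_of_nonneg (H.DH2.d0 n)]
    have h6 := abs_sub_abs_le_abs_sub (DS (dd' N) a - DS (dd' N) b)
      ((((a n : ℕ) : ℝ) - ((b n : ℕ) : ℝ)) * dd' N n)
    have h7 : |DS (dd' N) a - DS (dd' N) b| ≤ 2 * k * dd' N n := by
      nlinarith [H.DH2.d0 n]
    rw [hd] at h7
    calc _ ≤ _ := h7
      _ = _ := by rw [hu]; field_simp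
  refine h4.trans ?_
  have h8 : (2 * u * (PP N n)⁻¹) = ((2 * u * (PP N n)⁻¹)^p)^(1/p) := by
    rw [← Real.rpow_mul (by positivity)]; simp [hp0.ne']
  rw [h8]
  refine Real.rpow_le_rpow (by positivity) ?_ (by positivity)
  have h9 : u ^ p ≤ u := by
    calc u ^ p ≤ u ^ (1:ℝ) := Real.rpow_le_rpow_of_exponent_ge hu0 hu1 H.p1.le
      _ = u := Real.rpow_one u
  have h10 : ((PP N n)⁻¹) ^ p = LL N p n := by
    unfold LL; rw [Real.rpow_neg hP.le, Real.inv_rpow hP.le]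
  rw [Real.mul_rpow (by positivity) (by positivity), Real.mul_rpow (by positivity) (by positivity),
    h10, Real.rpow_add (by norm_num), Real.rpow_one]
  have h11 : u * LL N p n / 2 ≤ |DS (dd N p) a - DS (dd N p) b| := by
    refine le_trans (le_of_eq ?_) h2
    unfold dd; rw [hu]; field_simp
  have h12 : (0:ℝ) < 2 ^ p := by positivity
  calc (2:ℝ) ^ p * u ^ p * LL N p n ≤ 2 ^ p * u * LL N p n := by
        have := H.Lpos n
        gcongr
    _ = 2 ^ p * 2 * (u * LL N p n / 2) := by ring
    _ ≤ _ := by gcongr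

lemma nonempty (H : Par N p) : Nonempty (Dig N) :=
  ⟨fun n => ⟨0, by have := H.N2 n; omega⟩⟩

lemma surj (H : Par N p) {y : ℝ} (hy0 : 0 ≤ y) (hy1 : y < 1) :
    ∃ a : Dig N, DS (dd' N) a = y := by
  let Q : ℕ → ℕ := fun n => ∏ k ∈ Finset.range n, N k
  have hQ : ∀ n, (Q n : ℝ) = PP N n := fun n => by simp [Q, PP]
  have hQs : ∀ n, Q (n+1) = Q n * N n := fun n => Finset.prod_range_succ _ _
  let f : ℕ → ℕ := fun n => ⌊(Q n : ℝ) * y⌋₊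
  have hf : ∀ n, (f n : ℝ) ≤ Q n * y := fun n => Nat.floor_le (by positivity)
  have hf' : ∀ n, (Q n : ℝ) * y < f n + 1 := fun n => Nat.lt_floor_add_one _
  have hlow : ∀ n, f n * N n ≤ f (n+1) := fun n => by
    apply Nat.le_floor
    rw [hQs]; push_cast
    nlinarith [hf n, H.Npos n]
  have hup : ∀ n, f (n+1) < f n * N n + N n := fun n => by
    have h1 := hf (n+1)
    have h2 := hf' n
    rw [hQs] at h1; push_cast at h1
    have : (f (n+1) : ℝ) < f n * N n + N n := by nlinarith [H.Npos n]
    exact_mod_cast this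
  let a : Dig N := fun n => ⟨f (n+1) - f n * N n, by have := hlow n; have := hup n; omega⟩
  have hsum : ∀ n, ∑ k ∈ Finset.range n, ((a k : ℕ) : ℝ) * dd' N k = f n / PP N n := by
    intro n
    induction n with
    | zero =>
      have : f 0 = 0 := by simp [f, Q, hy1]
      simp [this]
    | succ n ih =>
      rw [Finset.sum_range_succ, ih]
      have : ((a n : ℕ) : ℝ) = f (n+1) - f n * N n := by
        simp only [a]; rw [Nat.cast_sub (hlow n)]; push_cast; ring
      rw [this]; unfold dd'; rw [PP_succ]
      have h1 := (H.Ppos n).ne'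
      have h2 := (H.Npos n).ne'
      field_simp; ring
  refine ⟨a, ?_⟩
  have h1 := (H.DH2.summable a).hasSum.tendsto_sum_nat
  refine tendsto_nhds_unique h1 ?_
  simp only [hsum]
  have hinv : Tendsto (fun n => y - (PP N n)⁻¹) atTop (𝓝 y) := by
    simpa using (tendsto_inv_atTop_zero.comp H.Ptend).const_sub y
  refine tendsto_of_tendsto_of_tendsto_of_le_of_le hinv tendsto_const_nhds (fun n => ?_)
    (fun n => ?_)
  · have := H.Ppos n
    have h2 := hf' n
    rw [hQ] at h2
    simp only
    rw [le_div_iff₀ this, sub_mul, inv_mul_cancel₀ this.ne']; linarith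
  · have := H.Ppos n
    have h2 := hf n
    rw [hQ] at h2
    simp only
    rw [div_le_iff₀ this]; linarith

end Par

noncomputable def zz {N : ℕ → ℕ} (p : ℝ) (q : Dig N × Dig N) : ℂ :=
  ⟨DS (dd N p) q.1, DS (dd N p) q.2⟩

def KK (N : ℕ → ℕ) (p : ℝ) : Set ℂ := Set.range (zz (N := N) p)

namespace Par
variable {N : ℕ → ℕ} {p : ℝ}

lemma compact (H : Par N p) : IsCompact (KK N p) := by
  apply isCompact_range
  have h := H.DH1.continuous
  have : (zz (N := N) p) = fun q => ((DS (dd N p) q.1 : ℝ) : ℂ) + (DS (dd N p) q.2 : ℝ) * Complex.I := by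
    funext q; apply Complex.ext <;> simp [zz]
  rw [this]
  exact (Complex.continuous_ofReal.comp (h.comp continuous_fst)).add
    ((Complex.continuous_ofReal.comp (h.comp continuous_snd)).mul continuous_const)

lemma zz_le {a b : Dig N × Dig N} {t : ℝ} (h1 : |DS (dd N p) a.1 - DS (dd N p) b.1| ≤ t)
    (h2 : |DS (dd N p) a.2 - DS (dd N p) b.2| ≤ t) : ‖zz p a - zz p b‖ ≤ 2 * t := by
  have := Complex.norm_le_abs_re_add_abs_im (zz p a - zz p b)
  simp only [zz, Complex.sub_re, Complex.sub_im] at this ⊢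
  linarith

lemma gapP (H : Par N p) : GapP (KK N p) := by
  intro c hc R hR
  have hdt : Tendsto (dd N p) atTop (𝓝 0) :=
    squeeze_zero (fun n => (H.dpos n).le) H.d_le H.Ltend
  obtain ⟨n, hn1, hn2⟩ := ((hdt.eventually (gt_mem_nhds hR)).and
    (H.lim.eventually_ge_atTop (4 / c))).exists
  have hd := H.dpos n
  refine ⟨dd N p n / 2, by linarith, by linarith, ?_⟩
  rintro _ ⟨a, rfl⟩ _ ⟨b, rfl⟩
  rcases H.gap a.1 b.1 n with h1 | h1
  · rcases H.gap a.2 b.2 n with h2 | h2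
    · left
      refine (zz_le h1 h2).trans ?_
      rw [← H.Lsucc n]
      have : 4 ≤ c * (N n : ℝ)^(p-1) := by rw [div_le_iff₀ hc] at hn2; linarith
      nlinarith [H.Lpos (n+1)]
    · right; exact h2.trans (Complex.abs_im_le_norm (zz p a - zz p b))
  · right; exact h1.trans (Complex.abs_re_le_norm (zz p a - zz p b))

lemma upper (H : Par N p) : μH[2/p] (KK N p) ≠ ⊤ := by
  have hp0 : 0 < p := by linarith [H.p1]
  let ι : ℕ → Type := fun n => ((k : Fin n) → Fin (N k)) × ((k : Fin n) → Fin (N k))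
  let t : ∀ n, ι n → Set ℂ := fun n i => zz p '' {q | (∀ k : Fin n, q.1 k = i.1 k) ∧
    (∀ k : Fin n, q.2 k = i.2 k)}
  have hdiam : ∀ n i, ediam (t n i) ≤ ENNReal.ofReal (2 * LL N p n) := by
    intro n i
    apply ediam_le
    rintro _ ⟨a, ⟨ha1, ha2⟩, rfl⟩ _ ⟨b, ⟨hb1, hb2⟩, rfl⟩
    rw [edist_dist, dist_eq_norm]
    apply ENNReal.ofReal_le_ofReal
    apply zz_le
    · exact H.DH1.agree fun k hk => (ha1 ⟨k, hk⟩).trans (hb1 ⟨k, hk⟩).symm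
    · exact H.DH1.agree fun k hk => (ha2 ⟨k, hk⟩).trans (hb2 ⟨k, hk⟩).symm
  have key := Measure.hausdorffMeasure_le_liminf_sum (2/p) (KK N p) (l := atTop)
    (fun n => ENNReal.ofReal (2 * LL N p n))
    (by
      have := ENNReal.tendsto_ofReal (H.Ltend.const_mul 2)
      simpa using this)
    t (Eventually.of_forall hdiam)
    (Eventually.of_forall fun n => by
      rintro _ ⟨a, rfl⟩
      exact Set.mem_iUnion.2 ⟨⟨fun k => a.1 k, fun k => a.2 k⟩, a, ⟨fun _ => rfl, fun _ => rfl⟩, rfl⟩)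
  have hb : ∀ n, ∑ i, ediam (t n i) ^ (2/p) ≤ ENNReal.ofReal (2 ^ (2/p)) := by
    intro n
    have hL := H.Lpos n
    have hP := H.Ppos n
    have hcard : (Fintype.card (ι n) : ℝ) = PP N n * PP N n := by
      simp only [ι, Fintype.card_prod, Fintype.card_pi, Fintype.card_fin, PP]
      push_cast
      rw [Finset.prod_range]
    calc ∑ i, ediam (t n i) ^ (2/p) ≤ ∑ i : ι n, ENNReal.ofReal (2 * LL N p n) ^ (2/p) := by
          gcongr; exact hdiam n _
      _ = ENNReal.ofReal (Fintype.card (ι n) * (2 * LL N p n) ^ (2/p)) := by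
          rw [Finset.sum_const, nsmul_eq_mul, ENNReal.ofReal_rpow_of_pos (by positivity),
            ENNReal.ofReal_mul (by positivity), ENNReal.ofReal_natCast]; rfl
      _ = _ := by
          congr 1
          rw [hcard, Real.mul_rpow (by norm_num) hL.le]
          have : LL N p n ^ (2/p) = (PP N n * PP N n)⁻¹ := by
            unfold LL
            rw [← Real.rpow_mul hP.le]
            have : -p * (2/p) = -2 := by field_simp
            rw [this, Real.rpow_neg hP.le]
            congr 1
            rw [Real.rpow_two]; ring
          rw [this]; field_simp
  have : μH[2/p] (KK N p) ≤ ENNReal.ofReal (2 ^ (2/p)) := by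
    refine key.trans ?_
    refine (liminf_le_liminf (Eventually.of_forall hb)).trans ?_
    simp
  exact (this.trans_lt ENNReal.ofReal_lt_top).ne

lemma lowerM (H : Par N p) : μH[2/p] (KK N p) ≠ 0 := by
  have hp0 : 0 < p := by linarith [H.p1]
  have := H.nonempty
  let inv : ℝ → Dig N := Function.invFun (DS (dd N p))
  have hinv : ∀ a, DS (dd N p) (inv (DS (dd N p) a)) = DS (dd N p) a :=
    fun a => Function.invFun_eq ⟨a, rfl⟩
  let f : ℂ → ℝ × ℝ := fun z => (DS (dd' N) (inv z.re), DS (dd' N) (inv z.im))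
  set C : ℝ := (2^(p+1)) ^ (1/p) with hC
  have hC0 : 0 ≤ C := by positivity
  have hhold : ∀ a b : Dig N, |DS (dd' N) a - DS (dd' N) b| ≤
      C * |DS (dd N p) a - DS (dd N p) b| ^ (1/p) := fun a b => by
    have := H.holder a b
    rwa [Real.mul_rpow (by positivity) (abs_nonneg _)] at this
  have hf : HolderOnWith C.toNNReal (1/p).toNNReal f (KK N p) := by
    rintro _ ⟨a, rfl⟩ _ ⟨b, rfl⟩
    rw [edist_dist, edist_dist, Real.coe_toNNReal _ (by positivity),
      ENNReal.ofReal_rpow_of_nonneg dist_nonneg (by positivity)]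
    change _ ≤ ENNReal.ofReal C * _
    rw [← ENNReal.ofReal_mul hC0]
    apply ENNReal.ofReal_le_ofReal
    rw [Prod.dist_eq]
    apply max_le
    · refine (hhold _ _).trans ?_
      simp only [zz, hinv]
      gcongr
      rw [dist_eq_norm]
      exact Complex.abs_re_le_norm (zz p a - zz p b)
    · refine (hhold _ _).trans ?_
      simp only [zz, hinv]
      gcongr
      rw [dist_eq_norm]
      exact Complex.abs_im_le_norm (zz p a - zz p b)
  have himg : Set.Ico (0:ℝ) 1 ×ˢ Set.Ico (0:ℝ) 1 ⊆ f '' KK N p := by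
    rintro ⟨y1, y2⟩ ⟨⟨h1, h2⟩, ⟨h3, h4⟩⟩
    obtain ⟨a, ha⟩ := H.surj h1 h2
    obtain ⟨b, hb⟩ := H.surj h3 h4
    have hwd : ∀ a, DS (dd' N) (inv (DS (dd N p) a)) = DS (dd' N) a := fun a => by
      have := hhold (inv (DS (dd N p) a)) a
      rw [hinv] at this
      simp only [sub_self, abs_zero] at this
      rw [Real.zero_rpow (by positivity), mul_zero] at this
      exact sub_eq_zero.1 (abs_nonpos_iff.1 this)
    refine ⟨zz p (a, b), ⟨_, rfl⟩, ?_⟩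
    simp only [f, zz, hwd]
    simp only at ha hb
    rw [ha, hb]
  intro h0
  have h := hf.hausdorffMeasure_image_le (by simpa using hp0) (d := 2) (by norm_num)
  have e : ((1/p).toNNReal : ℝ) * 2 = 2/p := by
    rw [Real.coe_toNNReal _ (by positivity)]; ring
  rw [e, h0, mul_zero, hausdorffMeasure_prod_real] at h
  have h2 := (measure_mono himg).trans h
  rw [Measure.volume_eq_prod, Measure.prod_prod] at h2
  simp at h2

end Par

/-- For every `0 < s < 2` and `0 < c < ∞` there is a compact HNUP set `K ⊆ ℂ`
with `dim_H K = s` and `H^s(K) = c`. -/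
theorem stmt3 (s c : ℝ) (hs0 : 0 < s) (hs2 : s < 2) (hc : 0 < c) :
    ∃ K : Set ℂ, IsCompact K ∧ HNUP K ∧
      dimH K = ENNReal.ofReal s ∧ μH[s] K = ENNReal.ofReal c := by
  obtain ⟨N, H⟩ := exists_par (p := 2 / s) (by rw [lt_div_iff₀ hs0]; linarith)
  have e : 2 / (2 / s) = s := by field_simp
  have h0 := H.lowerM
  have h1 := H.upper
  rw [e] at h0 h1
  exact finish s c hs0 hc _ H.compact H.gapP h0 h1
end

section
/- Fix an integer m ≥ 2 and a sequence ā = (a_1, a_2, …) with 0 < a_k ≤ 1/(m+1) for all k, and let I_ā be the associated Cantor-like set with A_k = a_1⋯a_k. Then the Hausdorff dimension of I_ā is given by dim_H I_ā = liminf_{k→∞} (k · log m)/(−log A_k). -/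
open MeasureTheory Filter Metric

/-- `A_k = a_1 ⋯ a_k` (with `A_0 = 1`). -/
noncomputable def cantorA (a : ℕ → ℝ) (k : ℕ) : ℝ := ∏ i ∈ Finset.Icc 1 k, a i

/-- The Cantor-like set
`I_ā = { Σ_{k=1}^∞ d_k (A_{k−1} − A_k)/(m−1) : each d_k ∈ {0, 1, …, m−1} }`. -/
noncomputable def cantorLikeSet (m : ℕ) (a : ℕ → ℝ) : Set ℝ :=
  { x | ∃ d : ℕ → ℕ, (∀ k, d k < m) ∧
      x = ∑' k : ℕ, (d (k + 1) : ℝ) * (cantorA a k - cantorA a (k + 1)) / (m - 1) }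

open scoped Topology NNReal ENNReal

/-- The point with digit sequence `e`. -/
noncomputable def cantorPt (m : ℕ) (A : ℕ → ℝ) (e : ℕ → Fin m) : ℝ :=
  ∑' k : ℕ, ((e k : ℕ) : ℝ) * (A k - A (k + 1)) / (m - 1)

structure GoodSeq (m : ℕ) (A : ℕ → ℝ) : Prop where
  hm : 2 ≤ m
  zero : A 0 = 1
  pos : ∀ k, 0 < A k
  step : ∀ k, (m + 1) * A (k + 1) ≤ A k

namespace GoodSeq

variable {m : ℕ} {A : ℕ → ℝ}

lemma hmR (h : GoodSeq m A) : (2 : ℝ) ≤ m := by exact_mod_cast h.hm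

lemma anti (h : GoodSeq m A) : Antitone A := by
  refine antitone_nat_of_succ_le fun k => ?_
  have := h.step k
  have h1 := h.pos (k + 1)
  have := h.hmR
  nlinarith

lemma le_pow (h : GoodSeq m A) (k : ℕ) : A k ≤ (((m : ℝ) + 1)⁻¹) ^ k := by
  induction k with
  | zero => simp [h.zero]
  | succ k ih =>
    have h1 := h.step k
    have h2 := h.hmR
    have h3 : A (k + 1) ≤ A k * ((m : ℝ) + 1)⁻¹ := by
      rw [← div_eq_mul_inv, le_div_iff₀ (by linarith)]; linarith
    rw [pow_succ]
    exact h3.trans (mul_le_mul_of_nonneg_right ih (by positivity))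

lemma tendsto (h : GoodSeq m A) : Tendsto A atTop (𝓝 0) := by
  have h2 := h.hmR
  refine squeeze_zero (fun k => (h.pos k).le) h.le_pow ?_
  refine tendsto_pow_atTop_nhds_zero_of_lt_one (by positivity) ?_
  exact inv_lt_one_of_one_lt₀ (by linarith)

lemma hasSum (h : GoodSeq m A) (k : ℕ) :
    HasSum (fun j => A (j + k) - A (j + k + 1)) (A k) := by
  rw [hasSum_iff_tendsto_nat_of_nonneg]
  · have : ∀ n, ∑ i ∈ Finset.range n, (A (i + k) - A (i + k + 1)) = A k - A (n + k) := by
      intro n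
      have := Finset.sum_range_sub' (fun i => A (i + k)) n
      simp only [zero_add] at this
      rw [← this]
      refine Finset.sum_congr rfl fun i _ => ?_
      rw [show i + k + 1 = i + 1 + k by ring]
    simp_rw [this]
    have h2 : Tendsto (fun n => A (n + k)) atTop (𝓝 0) := (tendsto_add_atTop_iff_nat k).2 h.tendsto
    simpa using tendsto_const_nhds.sub h2
  · intro i
    have := h.anti (Nat.le_succ (i + k))
    simpa using this

lemma norm_le (h : GoodSeq m A) (D : ℕ → ℝ) (hD : ∀ j, |D j| ≤ m - 1) (j : ℕ) :
    ‖D j * (A j - A (j + 1)) / (m - 1)‖ ≤ A j - A (j + 1) := by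
  have h2 := h.hmR
  have h3 : 0 ≤ A j - A (j + 1) := sub_nonneg.2 (h.anti (Nat.le_succ j))
  have h4 : (0 : ℝ) < m - 1 := by linarith
  rw [norm_div, norm_mul, Real.norm_eq_abs, Real.norm_of_nonneg h3, Real.norm_of_nonneg h4.le,
    div_le_iff₀ h4, mul_comm]
  exact mul_le_mul_of_nonneg_left (hD j) h3

lemma summable (h : GoodSeq m A) (D : ℕ → ℝ) (hD : ∀ j, |D j| ≤ m - 1) :
    Summable (fun j => D j * (A j - A (j + 1)) / (m - 1)) :=
  Summable.of_norm_bounded (h.hasSum 0).summable (h.norm_le D hD)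

lemma tail_le (h : GoodSeq m A) (D : ℕ → ℝ) (hD : ∀ j, |D j| ≤ m - 1) (k : ℕ) :
    |∑' j, D (j + k) * (A (j + k) - A (j + k + 1)) / (m - 1)| ≤ A k :=
  tsum_of_norm_bounded (h.hasSum k) (fun j => h.norm_le D hD (j + k))

lemma digit_abs (e : ℕ → Fin m) (j : ℕ) : |((e j : ℕ) : ℝ)| ≤ m - 1 := by
  rw [abs_of_nonneg (by positivity)]
  have : (e j : ℕ) + 1 ≤ m := (e j).2
  have : (((e j : ℕ) : ℝ)) + 1 ≤ m := by exact_mod_cast this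
  linarith

lemma diff_abs (e e' : ℕ → Fin m) (j : ℕ) : |((e j : ℕ) : ℝ) - ((e' j : ℕ) : ℝ)| ≤ m - 1 := by
  have h1 := digit_abs e j
  have h2 := digit_abs e' j
  rw [abs_of_nonneg (by positivity)] at h1 h2
  have h3 : (0 : ℝ) ≤ ((e j : ℕ) : ℝ) := by positivity
  have h4 : (0 : ℝ) ≤ ((e' j : ℕ) : ℝ) := by positivity
  rw [abs_le]
  constructor <;> linarith

lemma sub_eq (h : GoodSeq m A) (e e' : ℕ → Fin m) (k : ℕ) (hk : ∀ i < k, e i = e' i) :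
    cantorPt m A e - cantorPt m A e' =
      ∑' j, (((e (j + k) : ℕ) : ℝ) - ((e' (j + k) : ℕ) : ℝ)) *
        (A (j + k) - A (j + k + 1)) / (m - 1) := by
  unfold cantorPt
  rw [← (h.summable _ (digit_abs e)).tsum_sub (h.summable _ (digit_abs e'))]
  have hs := h.summable _ (diff_abs e e')
  have : ∀ j, ((e j : ℕ) : ℝ) * (A j - A (j + 1)) / (m - 1)
      - ((e' j : ℕ) : ℝ) * (A j - A (j + 1)) / (m - 1)
      = (((e j : ℕ) : ℝ) - ((e' j : ℕ) : ℝ)) * (A j - A (j + 1)) / (m - 1) := by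
    intro j; ring
  simp_rw [this]
  rw [← hs.sum_add_tsum_nat_add k, Finset.sum_eq_zero, zero_add]
  intro i hi
  rw [hk i (Finset.mem_range.1 hi)]
  simp

lemma dist_le (h : GoodSeq m A) (e e' : ℕ → Fin m) (k : ℕ) (hk : ∀ i < k, e i = e' i) :
    |cantorPt m A e - cantorPt m A e'| ≤ A k := by
  rw [h.sub_eq e e' k hk]
  exact h.tail_le _ (diff_abs e e') k

lemma le_dist (h : GoodSeq m A) (e e' : ℕ → Fin m) (k : ℕ) (hk : ∀ i < k, e i = e' i)
    (hne : e k ≠ e' k) :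
    A k * (((m : ℝ) + 1) * (m - 1))⁻¹ ≤ |cantorPt m A e - cantorPt m A e'| := by
  have h2 := h.hmR
  have h4 : (0 : ℝ) < m - 1 := by linarith
  rw [h.sub_eq e e' k hk]
  have hs := (_root_.summable_nat_add_iff k).2 (h.summable _ (diff_abs e e'))
  rw [hs.tsum_eq_zero_add]
  have ht := h.tail_le _ (diff_abs e e') (k + 1)
  have heq : ∀ j, j + 1 + k = j + (k + 1) := fun j => by ring
  simp_rw [heq, zero_add]
  set T := ∑' j, (((e (j + (k + 1)) : ℕ) : ℝ) - ((e' (j + (k + 1)) : ℕ) : ℝ)) *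
        (A (j + (k + 1)) - A (j + (k + 1) + 1)) / (m - 1) with hT
  have hd : (1 : ℝ) ≤ |((e k : ℕ) : ℝ) - ((e' k : ℕ) : ℝ)| := by
    have : ((e k : ℕ) : ℤ) - ((e' k : ℕ) : ℤ) ≠ 0 := by
      intro h0
      apply hne
      ext
      omega
    have := Int.one_le_abs this
    exact_mod_cast this
  have h3 : 0 ≤ A k - A (k + 1) := sub_nonneg.2 (h.anti (Nat.le_succ k))
  have hlow : (A k - A (k + 1)) / (m - 1) ≤
      |(((e k : ℕ) : ℝ) - ((e' k : ℕ) : ℝ)) * (A k - A (k + 1)) / (m - 1)| := by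
    rw [abs_div, abs_mul, abs_of_nonneg h3, abs_of_pos h4]
    gcongr
    nlinarith
  have htri := abs_sub_abs_le_abs_add
    ((((e k : ℕ) : ℝ) - ((e' k : ℕ) : ℝ)) * (A k - A (k + 1)) / (m - 1)) T
  have hfin : A k * (((m : ℝ) + 1) * (m - 1))⁻¹ ≤ (A k - A (k + 1)) / (m - 1) - A (k + 1) := by
    have hst := h.step k
    have e1 : (A k - A (k + 1)) / (m - 1) - A (k + 1) = (A k - m * A (k + 1)) / (m - 1) := by
      field_simp; ring
    rw [e1, mul_inv, ← mul_assoc, ← div_eq_mul_inv (_ * _)]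
    gcongr
    rw [← div_eq_mul_inv, div_le_iff₀ (by linarith)]
    nlinarith
  linarith

lemma exists_first (e e' : ℕ → Fin m) (hne : e ≠ e') :
    ∃ k, (∀ i < k, e i = e' i) ∧ e k ≠ e' k := by
  classical
  have hex : ∃ k, e k ≠ e' k := Function.ne_iff.1 hne
  refine ⟨Nat.find hex, fun i hi => ?_, Nat.find_spec hex⟩
  exact not_not.1 (Nat.find_min hex hi)

lemma gap_pos (h : GoodSeq m A) : 0 < (((m : ℝ) + 1) * (m - 1))⁻¹ := by
  have h2 := h.hmR
  have h4 : (0 : ℝ) < m - 1 := by linarith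
  positivity

lemma inj (h : GoodSeq m A) : Function.Injective (cantorPt m A) := by
  intro e e' hee
  by_contra hne
  obtain ⟨k, hk, hk'⟩ := exists_first e e' hne
  have := h.le_dist e e' k hk hk'
  rw [hee, sub_self, abs_zero] at this
  exact absurd (mul_pos (h.pos k) h.gap_pos) (not_lt.2 this)

lemma dimH_le' (h : GoodSeq m A) (t : ℝ≥0)
    (ht : ∃ᶠ k in atTop, (m : ℝ) ^ k * A k ^ (t : ℝ) ≤ 1) :
    dimH (Set.range (cantorPt m A)) ≤ t := by
  apply dimH_le_of_hausdorffMeasure_ne_top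
  refine ne_top_of_le_ne_top ENNReal.one_ne_top ?_
  have hdiam : ∀ (k : ℕ) (i : Fin k → Fin m),
      Metric.ediam (cantorPt m A '' {e | ∀ j : Fin k, e j = i j}) ≤ ENNReal.ofReal (A k) := by
    intro k i
    refine Metric.ediam_le ?_
    rintro _ ⟨e, he, rfl⟩ _ ⟨e', he', rfl⟩
    rw [edist_dist, Real.dist_eq]
    refine ENNReal.ofReal_le_ofReal (h.dist_le e e' k fun j hj => ?_)
    rw [he ⟨j, hj⟩, ← he' ⟨j, hj⟩]
  refine (MeasureTheory.Measure.hausdorffMeasure_le_liminf_sum (ι := fun k => (Fin k → Fin m))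
    (t : ℝ) (Set.range (cantorPt m A)) (l := atTop)
    (fun k => ENNReal.ofReal (A k)) ?_
    (fun k i => cantorPt m A '' {e | ∀ j : Fin k, e j = i j}) ?_ ?_).trans ?_
  · simpa using ENNReal.tendsto_ofReal h.tendsto
  · exact Eventually.of_forall hdiam
  · refine Eventually.of_forall fun k => ?_
    rintro _ ⟨e, rfl⟩
    exact Set.mem_iUnion.2 ⟨fun j => e j, e, fun j => rfl, rfl⟩
  · refine Filter.liminf_le_of_frequently_le' (ht.mono fun k hk => ?_)
    calc ∑ i : Fin k → Fin m,
          Metric.ediam (cantorPt m A '' {e | ∀ j : Fin k, e j = i j}) ^ (t : ℝ)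
        ≤ ∑ i : Fin k → Fin m, ENNReal.ofReal (A k) ^ (t : ℝ) :=
          Finset.sum_le_sum fun i _ => ENNReal.rpow_le_rpow (hdiam k i) t.2
      _ = ENNReal.ofReal ((m : ℝ) ^ k * A k ^ (t : ℝ)) := by
          rw [ENNReal.ofReal_rpow_of_pos (h.pos k), ENNReal.ofReal_mul (by positivity),
            ENNReal.ofReal_pow (by positivity), ENNReal.ofReal_natCast]
          simp
      _ ≤ 1 := by
          rw [← ENNReal.ofReal_one]
          exact ENNReal.ofReal_le_ofReal hk

lemma le_dimH' (h : GoodSeq m A) (t : ℝ≥0) (ht0 : 0 < t)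
    (ht : ∀ᶠ k in atTop, 1 ≤ (m : ℝ) ^ k * A k ^ (t : ℝ)) :
    t ≤ dimH (Set.range (cantorPt m A)) := by
  have h2 := h.hmR
  obtain ⟨N, hN⟩ := eventually_atTop.1 ht
  have hc := h.gap_pos
  set c := (((m : ℝ) + 1) * (m - 1))⁻¹ with hcdef
  have hAN := h.pos N
  have htR : (0 : ℝ) < t := ht0
  have hbound : ∀ k, ((m : ℝ) ^ k)⁻¹ * A N ^ (t : ℝ) ≤ A k ^ (t : ℝ) := by
    intro k
    have hmk : (1 : ℝ) ≤ (m : ℝ) ^ k := one_le_pow₀ (by linarith)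
    have hAN1 : A N ≤ 1 := by rw [← h.zero]; exact h.anti (Nat.zero_le N)
    rcases le_total N k with hk | hk
    · have h1 : A N ^ (t : ℝ) ≤ 1 := Real.rpow_le_one hAN.le hAN1 htR.le
      rw [inv_mul_le_iff₀ (by linarith)]
      exact h1.trans (hN k hk)
    · have h1 : A N ^ (t : ℝ) ≤ A k ^ (t : ℝ) := Real.rpow_le_rpow hAN.le (h.anti hk) htR.le
      refine le_trans (mul_le_of_le_one_left (by positivity) ?_) h1
      exact inv_le_one_of_one_le₀ hmk
  have : Nonempty (Fin m) := ⟨⟨0, by have := h.hm; omega⟩⟩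
  have hhol : HolderOnWith (Real.toNNReal ((A N * c) ^ (t : ℝ))⁻¹) t
      (fun x => Real.ofDigits (Function.invFun (cantorPt m A) x))
      (Set.range (cantorPt m A)) := by
    rintro _ ⟨e, rfl⟩ _ ⟨e', rfl⟩
    simp only [Function.leftInverse_invFun h.inj _]
    by_cases hne : e = e'
    · subst hne; simp
    obtain ⟨k, hk, hk'⟩ := exists_first e e' hne
    have hlow := h.le_dist e e' k hk hk'
    have hup := Real.abs_ofDigits_sub_ofDigits_le hk
    rw [edist_dist, edist_dist, Real.dist_eq, Real.dist_eq,
      ENNReal.ofReal_rpow_of_nonneg (abs_nonneg _) htR.le]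
    change _ ≤ ENNReal.ofReal _ * _
    rw [← ENNReal.ofReal_mul (by positivity)]
    refine ENNReal.ofReal_le_ofReal (hup.trans ?_)
    rw [← div_eq_inv_mul, le_div_iff₀ (by positivity), Real.mul_rpow hAN.le hc.le]
    calc ((m : ℝ) ^ k)⁻¹ * (A N ^ (t : ℝ) * c ^ (t : ℝ))
        = (((m : ℝ) ^ k)⁻¹ * A N ^ (t : ℝ)) * c ^ (t : ℝ) := by ring
      _ ≤ A k ^ (t : ℝ) * c ^ (t : ℝ) :=
          mul_le_mul_of_nonneg_right (hbound k) (by positivity)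
      _ = (A k * c) ^ (t : ℝ) := (Real.mul_rpow (h.pos k).le hc.le).symm
      _ ≤ _ := Real.rpow_le_rpow (mul_nonneg (h.pos k).le hc.le) hlow htR.le
  have hdim := hhol.dimH_image_le ht0
  have hsub : Set.Icc (0 : ℝ) 1 ⊆ (fun x => Real.ofDigits (Function.invFun (cantorPt m A) x)) ''
      (Set.range (cantorPt m A)) := by
    intro y hy
    obtain ⟨e, -, he⟩ := Real.ofDigits_SurjOn (b := m) (by have := h.hm; omega) hy
    refine ⟨_, ⟨e, rfl⟩, ?_⟩
    simp only [Function.leftInverse_invFun h.inj _]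
    exact he
  have hone : dimH (Set.Icc (0 : ℝ) 1) = 1 := by
    rw [Real.dimH_of_nonempty_interior (by simp)]
    simp
  have h1 := (hone ▸ dimH_mono hsub).trans hdim
  have h3 : (t : ℝ≥0∞) ≠ 0 := by simpa using ht0.ne'
  rw [ENNReal.le_div_iff_mul_le (Or.inl h3) (Or.inl ENNReal.coe_ne_top), one_mul] at h1
  exact h1

lemma log_pos (h : GoodSeq m A) (k : ℕ) (hk : 1 ≤ k) :
    (k : ℝ) * Real.log m ≤ -Real.log (A k) ∧ 0 < -Real.log (A k) := by
  have h2 := h.hmR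
  have h1 := Real.log_le_log (h.pos k) (h.le_pow k)
  rw [Real.log_pow, Real.log_inv] at h1
  have h3 : Real.log m ≤ Real.log (m + 1) := Real.log_le_log (by linarith) (by linarith)
  have h4 : 0 < Real.log m := Real.log_pos (by linarith)
  have hk' : (1 : ℝ) ≤ k := by exact_mod_cast hk
  constructor <;> nlinarith

lemma expr_eq (h : GoodSeq m A) (k : ℕ) (t : ℝ) :
    (m : ℝ) ^ k * A k ^ t = Real.exp (k * Real.log m - t * (-Real.log (A k))) := by
  have h2 := h.hmR
  rw [Real.rpow_def_of_pos (h.pos k), ← Real.rpow_natCast, Real.rpow_def_of_pos (by linarith),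
    ← Real.exp_add]
  congr 1
  ring

theorem main (h : GoodSeq m A) :
    dimH (Set.range (cantorPt m A)) =
      ENNReal.ofReal (Filter.liminf
        (fun k : ℕ => (k : ℝ) * Real.log m / (-Real.log (A k))) Filter.atTop) := by
  set u := (fun k : ℕ => (k : ℝ) * Real.log m / (-Real.log (A k))) with hu
  have hlm : 0 < Real.log m := Real.log_pos (by have := h.hmR; linarith)
  have hu0 : ∀ k, 0 ≤ u k := by
    intro k
    rcases Nat.eq_zero_or_pos k with rfl | hk
    · simp [hu]
    · exact div_nonneg (by positivity) (h.log_pos k hk).2.le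
  have hu1 : ∀ k, u k ≤ 1 := by
    intro k
    rcases Nat.eq_zero_or_pos k with rfl | hk
    · simp [hu]
    · exact div_le_one_of_le₀ (h.log_pos k hk).1 (h.log_pos k hk).2.le
  have hbb : IsBoundedUnder (· ≥ ·) atTop u := isBoundedUnder_of ⟨0, hu0⟩
  have hba : IsBoundedUnder (· ≤ ·) atTop u := isBoundedUnder_of ⟨1, hu1⟩
  have hco : IsCoboundedUnder (· ≥ ·) atTop u := hba.isCoboundedUnder_ge
  apply le_antisymm
  · refine le_of_forall_gt fun c hc => ?_
    obtain ⟨t, ht1, ht2⟩ := ENNReal.lt_iff_exists_nnreal_btwn.1 hc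
    refine lt_of_le_of_lt (h.dimH_le' t ?_) ht2
    have hlt : liminf u atTop < t := by
      have h5 : Real.toNNReal (liminf u atTop) < t := ENNReal.coe_lt_coe.1 ht1
      exact (Real.le_coe_toNNReal _).trans_lt (by exact_mod_cast h5)
    have hf := frequently_lt_of_liminf_lt hco hlt
    refine (hf.and_eventually (eventually_ge_atTop 1)).mono ?_
    rintro k ⟨hk, hk1⟩
    rw [h.expr_eq, Real.exp_le_one_iff]
    have := (div_lt_iff₀ (h.log_pos k hk1).2).1 hk
    linarith
  · refine le_of_forall_lt fun c hc => ?_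
    obtain ⟨t, ht1, ht2⟩ := ENNReal.lt_iff_exists_nnreal_btwn.1 hc
    refine lt_of_lt_of_le ht1 (h.le_dimH' t ?_ ?_)
    · have := lt_of_le_of_lt (zero_le) ht1
      exact_mod_cast this
    have hlt : (t : ℝ) < liminf u atTop := by
      rw [ENNReal.lt_ofReal_iff_toReal_lt ENNReal.coe_ne_top] at ht2
      exact ht2
    filter_upwards [eventually_lt_of_lt_liminf hlt hbb, eventually_ge_atTop 1] with k hk hk1
    rw [h.expr_eq, Real.one_le_exp_iff]
    have := (lt_div_iff₀ (h.log_pos k hk1).2).1 hk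
    linarith

end GoodSeq

lemma cantorLikeSet_eq_range (m : ℕ) (a : ℕ → ℝ) :
    cantorLikeSet m a = Set.range (cantorPt m (cantorA a)) := by
  ext x
  constructor
  · rintro ⟨d, hd, rfl⟩
    exact ⟨fun k => ⟨d (k + 1), hd _⟩, rfl⟩
  · rintro ⟨e, rfl⟩
    exact ⟨fun k => e (k - 1), fun k => (e (k - 1)).2, rfl⟩

lemma goodSeq_cantorA (m : ℕ) (hm : 2 ≤ m) (a : ℕ → ℝ)
    (ha : ∀ k : ℕ, 1 ≤ k → 0 < a k ∧ a k ≤ 1 / (m + 1)) : GoodSeq m (cantorA a) := by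
  have hpos : ∀ k, 0 < cantorA a k := fun k =>
    Finset.prod_pos fun i hi => (ha i (Finset.mem_Icc.1 hi).1).1
  refine ⟨hm, by simp [cantorA], hpos, fun k => ?_⟩
  have h1 : cantorA a (k + 1) = cantorA a k * a (k + 1) := by
    unfold cantorA
    rw [Finset.prod_Icc_succ_top (by omega)]
  have h2 := (ha (k + 1) (by omega)).2
  rw [le_div_iff₀ (by positivity)] at h2
  rw [h1]
  have := hpos k
  nlinarith

/-- `dim_H I_ā = liminf_k (k · log m)/(−log A_k)`. -/
theorem stmt6 (m : ℕ) (hm : 2 ≤ m) (a : ℕ → ℝ)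
    (ha : ∀ k : ℕ, 1 ≤ k → 0 < a k ∧ a k ≤ 1 / (m + 1)) :
    dimH (cantorLikeSet m a) =
      ENNReal.ofReal (Filter.liminf
        (fun k : ℕ => (k : ℝ) * Real.log m / (-Real.log (cantorA a k))) Filter.atTop) := by
  rw [cantorLikeSet_eq_range]
  exact (goodSeq_cantorA m hm a ha).main
end

section
/- Fix an integer m ≥ 2. Let λ_m be the normalized Lebesgue probability measure on the interval (0, 1/(m+1)], and let λ̃_m = ⊗_{n=1}^∞ λ_m be the countable product probability measure on X = ∏_{n=1}^∞ (0, 1/(m+1)]. Then for λ̃_m-almost every ā = (a_1, a_2, …) ∈ X, the Cantor-like set I_ā is hereditarily non uniformly perfect and dim_H I_ā = (log m)/(log(m+1) + 1) > 0. -/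
open MeasureTheory Filter Metric

/-- `λ_m`, normalized Lebesgue measure on the interval `(0, 1/(m+1)]`,
a probability measure on `ℝ`. -/
noncomputable def lambdaM (m : ℕ) : Measure ℝ :=
  ((m : ENNReal) + 1) • (volume.restrict (Set.Ioc (0 : ℝ) (1 / (m + 1))))

lemma cantorA_succ (a : ℕ → ℝ) (k : ℕ) : cantorA a (k + 1) = cantorA a k * a (k + 1) := by
  unfold cantorA
  rw [Finset.prod_Icc_succ_top (by omega)]

/-- the coding map -/
noncomputable def cod (m : ℕ) (a : ℕ → ℝ) (D : ℕ → Fin m) : ℝ :=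
  ∑' k : ℕ, ((D k : ℕ) : ℝ) * (cantorA a k - cantorA a (k + 1)) / (m - 1)

lemma cantorLikeSet_eq (m : ℕ) (_hm : 2 ≤ m) (a : ℕ → ℝ) :
    cantorLikeSet m a = Set.range (cod m a) := by
  ext x
  constructor
  · rintro ⟨d, hd, rfl⟩
    exact ⟨fun k => ⟨d (k + 1), hd _⟩, rfl⟩
  · rintro ⟨D, rfl⟩
    refine ⟨fun k => D (k - 1), fun k => (D _).2, ?_⟩
    simp [cod]

section det
variable {m : ℕ} (hm : 2 ≤ m) {a : ℕ → ℝ} (ha : ∀ k, 0 < a k ∧ a k ≤ 1 / ((m : ℝ) + 1))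
include hm ha

lemma cantorA_pos (k : ℕ) : 0 < cantorA a k := Finset.prod_pos fun i _ => (ha i).1

lemma cantorA_succ_le (k : ℕ) : cantorA a (k + 1) * (m + 1) ≤ cantorA a k := by
  have h1 := cantorA_pos hm ha k
  have h2 := (ha (k + 1)).2
  rw [le_div_iff₀ (by positivity)] at h2
  rw [cantorA_succ]
  nlinarith

lemma cantorA_anti : Antitone (cantorA a) := by
  refine antitone_nat_of_succ_le fun k => ?_
  have h1 := cantorA_pos hm ha (k + 1)
  have h2 := cantorA_succ_le hm ha k
  have : (0 : ℝ) ≤ m := by positivity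
  nlinarith

lemma cantorA_le (k : ℕ) : cantorA a k ≤ (1 / 2) ^ k := by
  induction k with
  | zero => simp [cantorA]
  | succ k ih =>
    have h1 := cantorA_pos hm ha (k + 1)
    have h2 := cantorA_succ_le hm ha k
    have : (2 : ℝ) ≤ m := by exact_mod_cast hm
    rw [pow_succ]
    nlinarith

lemma cantorA_tendsto : Tendsto (cantorA a) atTop (nhds 0) :=
  squeeze_zero (fun k => (cantorA_pos hm ha k).le) (cantorA_le hm ha)
    (tendsto_pow_atTop_nhds_zero_of_lt_one (by norm_num) (by norm_num))

lemma tail_hasSum (n : ℕ) :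
    HasSum (fun k => cantorA a (k + n) - cantorA a (k + n + 1)) (cantorA a n) := by
  rw [hasSum_iff_tendsto_nat_of_nonneg]
  · have : ∀ N, ∑ k ∈ Finset.range N, (cantorA a (k + n) - cantorA a (k + n + 1))
        = cantorA a n - cantorA a (N + n) := by
      intro N
      have := Finset.sum_range_sub' (fun k => cantorA a (k + n)) N
      simp only [zero_add] at this
      rw [← this]
      refine Finset.sum_congr rfl fun k _ => ?_
      rw [show k + 1 + n = k + n + 1 by ring]
    simp_rw [this]
    have := (cantorA_tendsto hm ha).comp (tendsto_add_atTop_nat n)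
    simpa using tendsto_const_nhds.sub this
  · intro i
    have := cantorA_anti hm ha (Nat.le_succ (i + n))
    simp only [Nat.succ_eq_add_one] at this
    linarith

lemma term_bound (δ : ℕ → ℝ) (hδ : ∀ k, |δ k| ≤ m - 1) (k : ℕ) :
    ‖δ k * (cantorA a k - cantorA a (k + 1)) / (m - 1)‖ ≤ cantorA a k - cantorA a (k + 1) := by
  have h2 : (2 : ℝ) ≤ m := by exact_mod_cast hm
  have h3 : 0 ≤ cantorA a k - cantorA a (k + 1) := by
    have := cantorA_anti hm ha (Nat.le_succ k)
    simp only [Nat.succ_eq_add_one] at this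
    linarith
  rw [Real.norm_eq_abs, abs_div, abs_mul, abs_of_nonneg h3, abs_of_pos (a := (m : ℝ) - 1) (by linarith),
    div_le_iff₀ (by linarith), mul_comm]
  exact mul_le_mul_of_nonneg_left (hδ k) h3

lemma summable_gen (δ : ℕ → ℝ) (hδ : ∀ k, |δ k| ≤ m - 1) :
    Summable (fun k => δ k * (cantorA a k - cantorA a (k + 1)) / (m - 1)) :=
  Summable.of_norm_bounded (tail_hasSum hm ha 0).summable (term_bound hm ha δ hδ)

lemma tail_bound (δ : ℕ → ℝ) (hδ : ∀ k, |δ k| ≤ m - 1) (n : ℕ) :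
    |∑' k, δ k * (cantorA a k - cantorA a (k + 1)) / (m - 1)
      - ∑ k ∈ Finset.range n, δ k * (cantorA a k - cantorA a (k + 1)) / (m - 1)| ≤ cantorA a n := by
  rw [← (summable_gen hm ha δ hδ).sum_add_tsum_nat_add n, add_sub_cancel_left]
  exact tsum_of_norm_bounded (tail_hasSum hm ha n) fun k => term_bound hm ha δ hδ (k + n)

omit hm ha in
lemma digit_diff (D E : ℕ → Fin m) (k : ℕ) :
    |((D k : ℕ) : ℝ) - ((E k : ℕ) : ℝ)| ≤ m - 1 := by
  have h1 : ((D k : ℕ) : ℝ) + 1 ≤ m := by exact_mod_cast (D k).2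
  have h2 : ((E k : ℕ) : ℝ) + 1 ≤ m := by exact_mod_cast (E k).2
  have h3 : (0 : ℝ) ≤ (D k : ℕ) := by positivity
  have h4 : (0 : ℝ) ≤ (E k : ℕ) := by positivity
  rw [abs_le]; constructor <;> linarith

lemma cod_sub (D E : ℕ → Fin m) : cod m a D - cod m a E =
    ∑' k, (((D k : ℕ) : ℝ) - ((E k : ℕ) : ℝ)) * (cantorA a k - cantorA a (k + 1)) / (m - 1) := by
  have hs : ∀ D : ℕ → Fin m, ∀ k, |((D k : ℕ) : ℝ)| ≤ m - 1 := by
    intro D k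
    have h1 : ((D k : ℕ) : ℝ) + 1 ≤ m := by exact_mod_cast (D k).2
    rw [abs_of_nonneg (by positivity)]; linarith
  unfold cod
  rw [← (summable_gen hm ha _ (hs D)).tsum_sub (summable_gen hm ha _ (hs E))]
  refine tsum_congr fun k => ?_
  ring

lemma cod_near (D E : ℕ → Fin m) (n : ℕ) (h : ∀ k < n, D k = E k) :
    |cod m a D - cod m a E| ≤ cantorA a n := by
  rw [cod_sub hm ha]
  have := tail_bound hm ha _ (digit_diff D E) n
  rwa [Finset.sum_eq_zero, sub_zero] at this
  intro k hk
  simp [h k (Finset.mem_range.1 hk)]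

lemma cod_far (D E : ℕ → Fin m) (n : ℕ) (h : ∀ k < n, D k = E k) (hn : D n ≠ E n) :
    cantorA a n / ((m : ℝ) ^ 2 - 1) ≤ |cod m a D - cod m a E| := by
  rw [cod_sub hm ha]
  have := tail_bound hm ha _ (digit_diff D E) (n + 1)
  rw [Finset.sum_range_succ, Finset.sum_eq_zero, zero_add] at this
  swap
  · intro k hk
    simp [h k (Finset.mem_range.1 hk)]
  set S := ∑' k, (((D k : ℕ) : ℝ) - ((E k : ℕ) : ℝ)) * (cantorA a k - cantorA a (k + 1)) / (m - 1)
  have h1 : (1 : ℝ) ≤ |((D n : ℕ) : ℝ) - ((E n : ℕ) : ℝ)| := by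
    have : ((D n : ℕ) : ℤ) - ((E n : ℕ) : ℤ) ≠ 0 := by
      intro h0
      apply hn
      apply Fin.ext
      omega
    have := Int.one_le_abs this
    exact_mod_cast this
  have h2 : (2 : ℝ) ≤ m := by exact_mod_cast hm
  have h3 : 0 ≤ cantorA a n - cantorA a (n + 1) := by
    have := cantorA_anti hm ha (Nat.le_succ n)
    simp only [Nat.succ_eq_add_one] at this
    linarith
  have h4 : (cantorA a n - cantorA a (n + 1)) / (m - 1) ≤
      |(((D n : ℕ) : ℝ) - ((E n : ℕ) : ℝ)) * (cantorA a n - cantorA a (n + 1)) / (m - 1)| := by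
    rw [abs_div, abs_mul, abs_of_nonneg h3, abs_of_pos (a := (m : ℝ) - 1) (by linarith)]
    gcongr
    · linarith
    · nlinarith
  have h5 := abs_sub_abs_le_abs_sub
    ((((D n : ℕ) : ℝ) - ((E n : ℕ) : ℝ)) * (cantorA a n - cantorA a (n + 1)) / (m - 1)) S
  rw [abs_sub_comm] at this
  have h6 := cantorA_succ_le hm ha n
  have h7 : cantorA a n / ((m : ℝ) ^ 2 - 1) ≤
      (cantorA a n - cantorA a (n + 1)) / (m - 1) - cantorA a (n + 1) := by
    have : (cantorA a n - cantorA a (n + 1)) / (m - 1) - cantorA a (n + 1)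
      = (cantorA a n - m * cantorA a (n + 1)) * (m + 1) / ((m : ℝ) ^ 2 - 1) := by
      have : (m : ℝ) - 1 ≠ 0 := by linarith
      have : (m : ℝ) ^ 2 - 1 ≠ 0 := by nlinarith
      field_simp
      ring
    rw [this]
    apply div_le_div_of_nonneg_right _ (by nlinarith)
    nlinarith
  linarith

lemma hnup_det (hs : ∀ ε : ℝ, 0 < ε → ∀ N : ℕ, ∃ k, N ≤ k ∧ a (k + 1) ≤ ε) :
    HNUP (cantorLikeSet m a) := by
  rintro F hF ⟨hc, hnt, c, hc0, h⟩
  rw [cantorLikeSet_eq m hm] at hF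
  have h2 : (2 : ℝ) ≤ m := by exact_mod_cast hm
  have hM : 0 < (m : ℝ) ^ 2 - 1 := by nlinarith
  have hd : 0 < Metric.diam F := Metric.diam_pos hnt hc.isBounded
  obtain ⟨N, hN⟩ := ((cantorA_tendsto hm ha).eventually_lt_const
    (show 0 < Metric.diam F * ((m : ℝ) ^ 2 - 1) from mul_pos hd hM)).exists_forall_of_atTop
  obtain ⟨k, hk, hak⟩ := hs (c / ((m : ℝ) ^ 2 - 1)) (by positivity) N
  obtain ⟨x, hx⟩ := hnt.nonempty
  have hA := cantorA_pos hm ha k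
  obtain ⟨y, hy, hy1, hy2⟩ := h x hx (cantorA a k / ((m : ℝ) ^ 2 - 1)) (by positivity)
    (by rw [div_lt_iff₀ hM]; exact hN k hk)
  obtain ⟨D, rfl⟩ := hF hx
  obtain ⟨E, rfl⟩ := hF hy
  rw [Real.norm_eq_abs] at hy1 hy2
  by_cases hag : ∀ i < k + 1, E i = D i
  · have := cod_near hm ha E D (k + 1) hag
    rw [cantorA_succ] at this
    have h3 : cantorA a k * a (k + 1) ≤ cantorA a k * (c / ((m : ℝ) ^ 2 - 1)) := by gcongr
    have h4 : cantorA a k * (c / ((m : ℝ) ^ 2 - 1)) = c * (cantorA a k / ((m : ℝ) ^ 2 - 1)) := by ring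
    linarith
  · have hex : ∃ i, i < k + 1 ∧ E i ≠ D i := by simpa using hag
    classical
    have hsp := Nat.find_spec hex
    have := cod_far hm ha E D (Nat.find hex) (fun i hi => by
      have := Nat.find_min hex hi
      by_contra h'
      exact this ⟨by omega, h'⟩) hsp.2
    have h3 := cantorA_anti hm ha (show Nat.find hex ≤ k by omega)
    have : cantorA a k / ((m : ℝ) ^ 2 - 1) ≤ cantorA a (Nat.find hex) / ((m : ℝ) ^ 2 - 1) := by
      gcongr
    linarith

lemma log_tendsto {L : ℝ} 
    (hlim : Tendsto (fun n : ℕ => Real.log (cantorA a n) / n) atTop (nhds (-L)))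
    (u v : ℝ) (huv : u - v * L < 0) :
    Tendsto (fun n : ℕ => Real.exp (n * u + v * Real.log (cantorA a n))) atTop (nhds 0) := by
  refine Real.tendsto_exp_atBot.comp ?_
  have h1 : Tendsto (fun n : ℕ => u + v * (Real.log (cantorA a n) / n)) atTop (nhds (u + v * (-L))) :=
    tendsto_const_nhds.add (hlim.const_mul v)
  have h2 := h1.neg_mul_atTop (by linarith) (tendsto_natCast_atTop_atTop (R := ℝ))
  refine h2.congr' ?_
  filter_upwards [eventually_gt_atTop 0] with n hn
  have : (n : ℝ) ≠ 0 := by positivity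
  field_simp

lemma dim_upper {L : ℝ}
    (hlim : Tendsto (fun n : ℕ => Real.log (cantorA a n) / n) atTop (nhds (-L)))
    (s : NNReal) (hs : Real.log m - s * L < 0) : dimH (cantorLikeSet m a) ≤ s := by
  have hm0 : (0 : ℝ) < m := by positivity
  apply dimH_le_of_hausdorffMeasure_ne_top
  have key := MeasureTheory.Measure.hausdorffMeasure_le_liminf_sum (ι := fun n : ℕ => (Fin n → Fin m))
    (s : ℝ) (cantorLikeSet m a) (l := atTop) (fun n => ENNReal.ofReal (cantorA a n))
    (by simpa using ENNReal.tendsto_ofReal (cantorA_tendsto hm ha))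
    (fun n w => {x | ∃ D : ℕ → Fin m, (∀ i : Fin n, D i = w i) ∧ x = cod m a D})
    (by
      refine Eventually.of_forall fun n w => ?_
      apply Metric.ediam_le
      rintro x ⟨D, hD, rfl⟩ y ⟨E, hE, rfl⟩
      rw [edist_dist, Real.dist_eq]
      apply ENNReal.ofReal_le_ofReal
      apply cod_near hm ha
      intro k hk
      exact (hD ⟨k, hk⟩).trans (hE ⟨k, hk⟩).symm)
    (by
      refine Eventually.of_forall fun n => ?_
      rw [cantorLikeSet_eq m hm]
      rintro x ⟨D, rfl⟩
      exact Set.mem_iUnion.2 ⟨fun i => D i, D, fun i => rfl, rfl⟩)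
  have h0 : Tendsto (fun n : ℕ => ENNReal.ofReal (Real.exp (n * Real.log m + s * Real.log (cantorA a n)))) atTop (nhds 0) := by
    simpa using ENNReal.tendsto_ofReal (log_tendsto hm ha hlim (Real.log m) s hs)
  have : Measure.hausdorffMeasure (s : ℝ) (cantorLikeSet m a) ≤ 0 := by
    refine key.trans ?_
    rw [← h0.liminf_eq]
    refine liminf_le_liminf (Eventually.of_forall fun n => ?_)
    have hA := cantorA_pos hm ha n
    calc _ ≤ ∑ w : (Fin n → Fin m), ENNReal.ofReal (cantorA a n) ^ (s : ℝ) := by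
          refine Finset.sum_le_sum fun w _ => ?_
          apply ENNReal.rpow_le_rpow _ s.2
          apply Metric.ediam_le
          rintro x ⟨D, hD, rfl⟩ y ⟨E, hE, rfl⟩
          rw [edist_dist, Real.dist_eq]
          apply ENNReal.ofReal_le_ofReal
          apply cod_near hm ha
          intro k hk
          exact (hD ⟨k, hk⟩).trans (hE ⟨k, hk⟩).symm
      _ = _ := by
          rw [Finset.sum_const, Finset.card_univ, Fintype.card_fun, Fintype.card_fin, Fintype.card_fin,
            nsmul_eq_mul, ENNReal.ofReal_rpow_of_pos hA, Real.exp_add, ← Real.log_pow,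
            Real.exp_log (by positivity), ENNReal.ofReal_mul (by positivity), mul_comm (s : ℝ),
            ← Real.rpow_def_of_pos hA]
          congr 1
          rw [← ENNReal.ofReal_natCast]
          push_cast
          rfl
  rw [le_antisymm this bot_le]
  exact ENNReal.zero_ne_top

lemma dim_lower {L : ℝ}
    (hlim : Tendsto (fun n : ℕ => Real.log (cantorA a n) / n) atTop (nhds (-L)))
    (s : NNReal) (hs0 : 0 < s) (hs : s * L < Real.log m) : s ≤ dimH (cantorLikeSet m a) := by
  have hm0 : (0 : ℝ) < m := by positivity
  have h2 : (2 : ℝ) ≤ m := by exact_mod_cast hm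
  have hM : 0 < (m : ℝ) ^ 2 - 1 := by nlinarith
  obtain ⟨C, hC⟩ := (log_tendsto hm ha hlim (-Real.log m) (-s) (by linarith)).bddAbove_range
  have hC' : ∀ n : ℕ, ((m : ℝ) ^ n)⁻¹ ≤ C * cantorA a n ^ (s : ℝ) := by
    intro n
    have hA := cantorA_pos hm ha n
    have := hC ⟨n, rfl⟩
    simp only [Real.exp_add] at this
    rw [mul_neg, Real.exp_neg, ← Real.log_pow, Real.exp_log (by positivity), neg_mul, Real.exp_neg,
      mul_comm (s : ℝ), ← Real.rpow_def_of_pos hA] at this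
    rwa [← div_eq_mul_inv, div_le_iff₀ (by positivity)] at this
  have hC0 : 0 ≤ C := by
    have := hC' 0
    simp [cantorA] at this
    linarith
  -- digits
  have hinv : ∀ x ∈ cantorLikeSet m a, ∃ D : ℕ → Fin m, cod m a D = x := by
    intro x hx
    rwa [cantorLikeSet_eq m hm] at hx
  have hmp : 0 < m := by omega
  have : ∀ x : ℝ, ∃ D : ℕ → Fin m, x ∈ cantorLikeSet m a → cod m a D = x := by
    intro x
    by_cases hx : x ∈ cantorLikeSet m a
    · obtain ⟨D, hD⟩ := hinv x hx
      exact ⟨D, fun _ => hD⟩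
    · exact ⟨fun _ => ⟨0, hmp⟩, fun h => absurd h hx⟩
  choose dg hdg using this
  have hinj : Function.Injective (cod m a) := by
    intro D E hDE
    by_contra hne
    have hex : ∃ i, D i ≠ E i := Function.ne_iff.1 hne
    classical
    have := cod_far hm ha D E (Nat.find hex) (fun i hi => by
      have := Nat.find_min hex hi
      simpa using this) (Nat.find_spec hex)
    rw [hDE, sub_self, abs_zero] at this
    have hA := cantorA_pos hm ha (Nat.find hex)
    have : 0 < cantorA a (Nat.find hex) / ((m : ℝ) ^ 2 - 1) := by positivity
    linarith
  let f : ℝ → ℝ := fun x => Real.ofDigits (dg x)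
  have himg : Set.Icc 0 1 ⊆ f '' cantorLikeSet m a := by
    intro y hy
    obtain ⟨D, -, rfl⟩ := Real.ofDigits_SurjOn (b := m) (by omega) hy
    have hx : cod m a D ∈ cantorLikeSet m a := by
      rw [cantorLikeSet_eq m hm]; exact ⟨D, rfl⟩
    refine ⟨cod m a D, hx, ?_⟩
    have := hinj (hdg _ hx)
    simp only [f, this]
  let K : ℝ := C * ((m : ℝ) ^ 2 - 1) ^ (s : ℝ)
  have hK : 0 ≤ K := by positivity
  have hhol : HolderOnWith K.toNNReal s f (cantorLikeSet m a) := by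
    intro x hx y hy
    have hmain : |f x - f y| ≤ K * |x - y| ^ (s : ℝ) := by
      by_cases hne : dg x = dg y
      · simp only [f, hne, sub_self, abs_zero]
        positivity
      have hex : ∃ i, dg x i ≠ dg y i := Function.ne_iff.1 hne
      classical
      have hag : ∀ i < Nat.find hex, dg x i = dg y i := fun i hi => by
        have := Nat.find_min hex hi
        simpa using this
      have h3 := cod_far hm ha (dg x) (dg y) (Nat.find hex) hag (Nat.find_spec hex)
      rw [hdg x hx, hdg y hy] at h3
      have h4 := Real.abs_ofDigits_sub_ofDigits_le hag
      have hA := cantorA_pos hm ha (Nat.find hex)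
      rw [div_le_iff₀ hM] at h3
      calc |f x - f y| ≤ _ := h4
        _ ≤ _ := hC' _
        _ ≤ C * (|x - y| * ((m : ℝ) ^ 2 - 1)) ^ (s : ℝ) := by gcongr
        _ = _ := by rw [Real.mul_rpow (abs_nonneg _) hM.le]; simp only [K]; ring
    rw [edist_dist, edist_dist, Real.dist_eq, Real.dist_eq,
      ENNReal.ofReal_rpow_of_nonneg (abs_nonneg (x - y)) (NNReal.coe_nonneg s)]
    rw [show ((K.toNNReal : NNReal) : ENNReal) = ENNReal.ofReal K from rfl, ← ENNReal.ofReal_mul hK]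
    exact ENNReal.ofReal_le_ofReal hmain
  have h5 := hhol.dimH_image_le hs0
  have h6 : (1 : ENNReal) ≤ dimH (f '' cantorLikeSet m a) := by
    refine le_trans ?_ (dimH_mono himg)
    rw [Real.dimH_of_nonempty_interior (by rw [interior_Icc]; exact ⟨1/2, by norm_num, by norm_num⟩)]
    simp
  have h7 := h6.trans h5
  rw [ENNReal.le_div_iff_mul_le (Or.inl (by exact_mod_cast hs0.ne')) (Or.inl ENNReal.coe_ne_top)] at h7
  simpa using h7

lemma dim_det {L : ℝ} (hL : 0 < L)
    (hlim : Tendsto (fun n : ℕ => Real.log (cantorA a n) / n) atTop (nhds (-L))) :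
    dimH (cantorLikeSet m a) = ENNReal.ofReal (Real.log m / L) := by
  apply le_antisymm
  · refine ENNReal.le_of_forall_pos_le_add fun ε hε _ => ?_
    refine (dim_upper hm ha hlim ((Real.log m / L).toNNReal + ε) ?_).trans ?_
    · push_cast
      have := Real.le_coe_toNNReal (Real.log m / L)
      have h1 : Real.log m = Real.log m / L * L := by field_simp
      have : (0 : ℝ) < ε := hε
      nlinarith
    · push_cast
      rfl
  · refine le_of_forall_lt fun t ht => ?_
    obtain ⟨r, hr1, hr2⟩ := ENNReal.lt_iff_exists_nnreal_btwn.1 ht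
    refine hr1.trans_le (dim_lower hm ha hlim r ?_ ?_)
    · have : (0 : ENNReal) < r := bot_le.trans_lt hr1
      exact_mod_cast this
    · rw [← lt_div_iff₀ hL]
      have := (ENNReal.lt_ofReal_iff_toReal_lt ENNReal.coe_ne_top).1 hr2
      simpa using this
end det

section prob
open ProbabilityTheory

lemma lambdaM_univ (m : ℕ) : lambdaM m Set.univ = 1 := by
  simp only [lambdaM, Measure.smul_apply, Measure.restrict_apply_univ, Real.volume_Ioc, smul_eq_mul,
    sub_zero]
  rw [show ((m : ENNReal) + 1) = ENNReal.ofReal ((m : ℝ) + 1) by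
    rw [ENNReal.ofReal_add (by positivity) (by norm_num)]; simp, ← ENNReal.ofReal_mul (by positivity),
    mul_one_div_cancel (by positivity), ENNReal.ofReal_one]

instance (m : ℕ) : IsProbabilityMeasure (lambdaM m) := ⟨lambdaM_univ m⟩

lemma lambdaM_log_integrable (m : ℕ) : Integrable Real.log (lambdaM m) := by
  unfold lambdaM
  apply Integrable.smul_measure
  · have := (intervalIntegral.intervalIntegrable_log' (a := 0) (b := 1 / ((m : ℝ) + 1)))
    rw [intervalIntegrable_iff_integrableOn_Ioc_of_le (by positivity)] at this
    exact this
  · simp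

lemma lambdaM_log_integral (m : ℕ) : ∫ x, Real.log x ∂(lambdaM m) = -(Real.log (m + 1) + 1) := by
  unfold lambdaM
  rw [integral_smul_measure, ← intervalIntegral.integral_of_le (by positivity), integral_log]
  rw [show (((m : ENNReal) + 1)).toReal = (m : ℝ) + 1 by
    rw [ENNReal.toReal_add (by simp) (by simp)]; simp]
  have : (m : ℝ) + 1 ≠ 0 := by positivity
  simp only [one_div, Real.log_inv, smul_eq_mul]
  field_simp
  simp
  ring

lemma lambdaM_Ioi_lt (m : ℕ) {ε : ℝ} (hε : 0 < ε) : lambdaM m (Set.Ioi ε) < 1 := by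
  have h : lambdaM m (Set.Iic ε) ≠ 0 := by
    simp only [lambdaM, Measure.smul_apply, smul_eq_mul]
    refine mul_ne_zero (by simp) ?_
    rw [Measure.restrict_apply measurableSet_Iic]
    have : Set.Ioc 0 (min ε (1 / ((m : ℝ) + 1))) ⊆ Set.Iic ε ∩ Set.Ioc (0 : ℝ) (1 / (m + 1)) := by
      rintro x ⟨h1, h2⟩
      exact ⟨h2.trans (min_le_left _ _), h1, h2.trans (min_le_right _ _)⟩
    refine (lt_of_lt_of_le ?_ (measure_mono this)).ne'
    rw [Real.volume_Ioc]
    simp only [sub_zero, ENNReal.ofReal_pos, lt_min_iff]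
    exact ⟨hε, by positivity⟩
  rw [← Set.compl_Iic, prob_compl_eq_one_sub measurableSet_Iic]
  exact ENNReal.sub_lt_self (by simp) (by simp) h

variable {m : ℕ} {P : Measure (ℕ → ℝ)}
    (hP : ∀ (s : Finset ℕ) (B : ℕ → Set ℝ), (∀ i, MeasurableSet (B i)) →
      P {x : ℕ → ℝ | ∀ i ∈ s, x i ∈ B i} = ∏ i ∈ s, lambdaM m (B i))
include hP

lemma P_prob : IsProbabilityMeasure P := ⟨by simpa using hP ∅ (fun _ => Set.univ) (fun _ => .univ)⟩

lemma P_coord (i : ℕ) {B : Set ℝ} (hB : MeasurableSet B) : P {x | x i ∈ B} = lambdaM m B := by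
  simpa using hP {i} (fun _ => B) (fun _ => hB)

lemma P_map (i : ℕ) : P.map (fun x => x i) = lambdaM m := by
  ext B hB
  rw [Measure.map_apply (measurable_pi_apply i) hB]
  exact P_coord hP i hB

lemma P_indep : iIndepFun (fun (i : ℕ) (x : ℕ → ℝ) => x i) P := by
  rw [iIndepFun_iff_measure_inter_preimage_eq_mul]
  intro S sets H
  classical
  have := hP S (fun i => if i ∈ S then sets i else Set.univ) (fun i => by
    by_cases h : i ∈ S
    · simp [h, H i h]
    · simp [h])
  have h1 : (⋂ i ∈ S, (fun x : ℕ → ℝ => x i) ⁻¹' sets i) =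
      {x : ℕ → ℝ | ∀ i ∈ S, x i ∈ (if i ∈ S then sets i else Set.univ)} := by
    ext x
    simp only [Set.mem_iInter, Set.mem_preimage, Set.mem_setOf_eq]
    refine forall₂_congr fun i hi => ?_
    simp [hi]
  rw [h1, this]
  refine Finset.prod_congr rfl fun i hi => ?_
  rw [if_pos hi, ← P_coord hP i (H i hi)]
  rfl

lemma P_ae_range : ∀ᵐ a ∂P, ∀ k, 0 < a k ∧ a k ≤ 1 / ((m : ℝ) + 1) := by
  rw [ae_all_iff]
  intro k
  have h : ∀ᵐ x ∂(lambdaM m), x ∈ Set.Ioc (0 : ℝ) (1 / ((m : ℝ) + 1)) := by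
    unfold lambdaM
    exact Measure.ae_smul_measure (ae_restrict_mem measurableSet_Ioc) _
  rw [← P_map hP k] at h
  exact ae_of_ae_map (measurable_pi_apply k).aemeasurable h

lemma P_ae_log : ∀ᵐ a ∂P, Tendsto (fun n : ℕ => (∑ i ∈ Finset.range n, Real.log (a (i + 1))) / n)
    atTop (nhds (-(Real.log (m + 1) + 1))) := by
  have hid : ∀ i : ℕ, IdentDistrib (fun a : ℕ → ℝ => a i) (fun a => a (0 + 1)) P P := fun i =>
    ⟨(measurable_pi_apply _).aemeasurable, (measurable_pi_apply _).aemeasurable, by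
      rw [P_map hP, P_map hP]⟩
  have hlogm : Measurable Real.log := Real.measurable_log
  have hae : AEStronglyMeasurable Real.log (P.map (fun x => x (0 + 1))) :=
    hlogm.aestronglyMeasurable
  have := strong_law_ae_real (μ := P) (fun i a => Real.log (a (i + 1)))
    (by
      have h := lambdaM_log_integrable m
      rw [← P_map hP (0 + 1)] at h
      exact h.comp_measurable (measurable_pi_apply _))
    (by
      intro i j hij
      have := (P_indep hP).indepFun (show i + 1 ≠ j + 1 by omega)
      exact this.comp hlogm hlogm)
    (fun i => (hid (i + 1)).comp hlogm)
  have hint : ∫ a, Real.log (a (0 + 1)) ∂P = -(Real.log (m + 1) + 1) := by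
    rw [← lambdaM_log_integral m, ← P_map hP (0 + 1),
      integral_map (measurable_pi_apply _).aemeasurable hae]
  rw [hint] at this
  exact this

lemma P_ae_small : ∀ᵐ a ∂P, ∀ ε : ℝ, 0 < ε → ∀ N : ℕ, ∃ k, N ≤ k ∧ a (k + 1) ≤ ε := by
  have h : ∀ᵐ a ∂P, ∀ j N : ℕ, ∃ k, N ≤ k ∧ a (k + 1) ≤ 1 / ((j : ℝ) + 1) := by
    rw [ae_all_iff]; intro j
    rw [ae_all_iff]; intro N
    have hε : (0 : ℝ) < 1 / ((j : ℝ) + 1) := by positivity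
    set ε := 1 / ((j : ℝ) + 1)
    rw [ae_iff]
    refine le_antisymm ?_ bot_le
    have hb : ∀ n : ℕ, P {a | ¬ ∃ k, N ≤ k ∧ a (k + 1) ≤ ε} ≤ lambdaM m (Set.Ioi ε) ^ n := by
      intro n
      have := hP (Finset.Ico (N + 1) (N + 1 + n)) (fun _ => Set.Ioi ε) (fun _ => measurableSet_Ioi)
      rw [Finset.prod_const, Nat.card_Ico, Nat.add_sub_cancel_left] at this
      rw [← this]
      apply measure_mono
      intro a ha i hi
      rw [Finset.mem_Ico] at hi
      simp only [Set.mem_setOf_eq, not_exists, not_and, not_le] at ha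
      have := ha (i - 1) (by omega)
      rwa [Nat.sub_add_cancel (by omega)] at this
    exact ge_of_tendsto' (ENNReal.tendsto_pow_atTop_nhds_zero_of_lt_one (lambdaM_Ioi_lt m hε)) hb
  filter_upwards [h] with a ha ε hε N
  obtain ⟨j, hj⟩ := exists_nat_one_div_lt hε
  obtain ⟨k, hk, hk'⟩ := ha j N
  exact ⟨k, hk, hk'.trans hj.le⟩
end prob

/-- For any measure `P` on `ℕ → ℝ` whose finite-dimensional cylinder distributions are
those of the countable product `λ̃_m = ⊗_{n} λ_m` (i.e. `P` is the product measure),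
`λ̃_m`-almost every `ā` yields a Cantor-like set `I_ā` which is HNUP and has
`dim_H I_ā = log m / (log(m+1) + 1) > 0`. -/
theorem stmt8 (m : ℕ) (hm : 2 ≤ m) (P : Measure (ℕ → ℝ))
    (hP : ∀ (s : Finset ℕ) (B : ℕ → Set ℝ), (∀ i, MeasurableSet (B i)) →
      P {x : ℕ → ℝ | ∀ i ∈ s, x i ∈ B i} = ∏ i ∈ s, lambdaM m (B i)) :
    0 < Real.log m / (Real.log (m + 1) + 1) ∧
    ∀ᵐ a ∂P, HNUP (cantorLikeSet m a) ∧
      dimH (cantorLikeSet m a) =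
        ENNReal.ofReal (Real.log m / (Real.log (m + 1) + 1)) := by
  have h2 : (2 : ℝ) ≤ m := by exact_mod_cast hm
  have hL : 0 < Real.log ((m : ℝ) + 1) + 1 := by
    have := Real.log_nonneg (show (1 : ℝ) ≤ m + 1 by linarith)
    linarith
  refine ⟨div_pos (Real.log_pos (by linarith)) hL, ?_⟩
  filter_upwards [P_ae_range hP, P_ae_log hP, P_ae_small hP] with a ha hlog hs
  refine ⟨hnup_det hm ha hs, dim_det hm ha hL ?_⟩
  refine hlog.congr fun n => ?_
  congr 1
  induction n with
  | zero => simp [cantorA]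
  | succ n ih =>
    rw [Finset.sum_range_succ, ih, cantorA_succ,
      Real.log_mul (cantorA_pos hm ha n).ne' (ha (n + 1)).1.ne']
end

section
/- There exists a compact hereditarily non uniformly perfect set W̃ ⊆ ℝ with positive 1-dimensional Lebesgue measure, H^1(W̃) > 0 (hence dim_H W̃ = 1). -/
open MeasureTheory Filter Metric

/-- Distance to the nearest integer. -/
noncomputable def dInt (x : ℝ) : ℝ := ‖(x : UnitAddCircle)‖

lemma dInt_le (x : ℝ) : dInt x ≤ |x| := by
  unfold dInt
  rw [AddCircle.norm_eq]
  simpa using round_le x 0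

lemma dInt_eq {x : ℝ} (h : |x| ≤ 1 / 2) : dInt x = |x| := by
  unfold dInt
  rw [AddCircle.norm_coe_eq_abs_iff _ one_ne_zero]
  simpa using h

lemma dInt_sub (x y : ℝ) : dInt (x - y) ≤ dInt x + dInt y := by
  unfold dInt
  rw [AddCircle.coe_sub]
  exact norm_sub_le _ _

lemma dInt_cont : Continuous dInt := by
  unfold dInt
  exact continuous_norm.comp (AddCircle.continuous_mk' 1)

/-- Points that come close to an integer at one of the scales `n^{-1}, …, n^{-m}`. -/
def blockSet (n m : ℕ) (δ : ℝ) : Set ℝ :=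
  {x | ∃ j : ℕ, j < m ∧ dInt ((n : ℝ) ^ (j + 1) * x) ≤ δ}

lemma blockSet_closed (n m : ℕ) (δ : ℝ) : IsClosed (blockSet n m δ) := by
  have : blockSet n m δ = ⋃ j ∈ Set.Iio m, {x | dInt ((n : ℝ) ^ (j + 1) * x) ≤ δ} := by
    ext x; simp [blockSet]
  rw [this]
  refine (Set.finite_Iio m).isClosed_biUnion fun j _ => ?_
  exact isClosed_le (dInt_cont.comp (by fun_prop)) continuous_const

lemma key (n : ℕ) (δ : ℝ) (hδ : 0 < δ) (hδ1 : δ ≤ 1) (hn : 4 ≤ n * δ) (m : ℕ) (F : Set ℝ)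
    (c : ℝ) (hc : 8 * δ ≤ c) (hne : F.Nonempty) (hd : 1 / (n : ℝ) < Metric.diam F)
    (h : ∀ a ∈ F, ∀ r : ℝ, 0 < r → r < Metric.diam F →
      ∃ y ∈ F, c * r < ‖y - a‖ ∧ ‖y - a‖ < r) : ¬ F ⊆ blockSet n m δ := by
  have hn1 : (1 : ℝ) ≤ n := by nlinarith
  have hn0 : (0 : ℝ) < n := by linarith
  have main : ∀ t : ℕ, ∃ a ∈ F, ∀ j < t,
      (n : ℝ) ^ (j + 1) * δ ≤ (n : ℝ) ^ t * (dInt ((n : ℝ) ^ (j + 1) * a) - δ) := by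
    intro t
    induction t with
    | zero => obtain ⟨a, ha⟩ := hne; exact ⟨a, ha, by simp⟩
    | succ t ih =>
      obtain ⟨a, ha, hj⟩ := ih
      have hp : (0 : ℝ) < (n : ℝ) ^ (t + 1) := by positivity
      by_cases hbig : 2 * δ ≤ dInt ((n : ℝ) ^ (t + 1) * a)
      · refine ⟨a, ha, fun j hjt => ?_⟩
        rcases Nat.lt_succ_iff_lt_or_eq.mp hjt with hlt | rfl
        · have h1 := hj j hlt
          have h2 : (0 : ℝ) < (n : ℝ) ^ (j + 1) * δ := by positivity
          rw [pow_succ (n : ℝ) t]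
          nlinarith
        · nlinarith
      · push Not at hbig
        have hr : (0 : ℝ) < 1 / (2 * (n : ℝ) ^ (t + 1)) := by positivity
        have hr2 : 1 / (2 * (n : ℝ) ^ (t + 1)) < Metric.diam F := by
          refine lt_of_le_of_lt ?_ hd
          apply one_div_le_one_div_of_le hn0
          have : (1 : ℝ) ≤ (n : ℝ) ^ t := one_le_pow₀ hn1
          rw [pow_succ]; nlinarith
        obtain ⟨y, hy, hy1, hy2⟩ := h a ha _ hr hr2
        rw [Real.norm_eq_abs] at hy1 hy2
        have e1 : (n : ℝ) ^ (t + 1) * |y - a| < 1 / 2 := by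
          have := mul_lt_mul_of_pos_left hy2 hp
          have e : (n : ℝ) ^ (t + 1) * (1 / (2 * (n : ℝ) ^ (t + 1))) = 1 / 2 := by field_simp
          linarith
        have e2 : c / 2 < (n : ℝ) ^ (t + 1) * |y - a| := by
          have := mul_lt_mul_of_pos_left hy1 hp
          have e : (n : ℝ) ^ (t + 1) * (c * (1 / (2 * (n : ℝ) ^ (t + 1)))) = c / 2 := by field_simp
          linarith
        refine ⟨y, hy, fun j hjt => ?_⟩
        rcases Nat.lt_succ_iff_lt_or_eq.mp hjt with hlt | rfl
        · have h1 := hj j hlt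
          set q : ℝ := (n : ℝ) ^ (j + 1) with hq
          have hq0 : 0 < q := by positivity
          have h3 : dInt (q * a) ≤ dInt (q * y) + q * |y - a| := by
            have h4 := dInt_sub (q * y) (q * (y - a))
            have h5 := dInt_le (q * (y - a))
            rw [abs_mul, abs_of_pos hq0] at h5
            have h6 : q * y - q * (y - a) = q * a := by ring
            rw [h6] at h4
            linarith
          have h7 : (n : ℝ) ^ (t + 1) * (dInt (q * a) - δ) ≥ n * (q * δ) := by
            rw [pow_succ]; nlinarith
          have h8 : (n : ℝ) ^ (t + 1) * (dInt (q * y) - δ) ≥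
              (n : ℝ) ^ (t + 1) * (dInt (q * a) - δ) - q * ((n : ℝ) ^ (t + 1) * |y - a|) := by
            nlinarith
          have h9 : q * ((n : ℝ) ^ (t + 1) * |y - a|) ≤ q * (1 / 2) := by gcongr
          have h10 : q * 4 ≤ q * (n * δ) := by gcongr
          have h11 : q * δ ≤ q * 1 := by gcongr
          nlinarith
        · set q : ℝ := (n : ℝ) ^ (j + 1) with hq
          have h4 := dInt_sub (q * y) (q * a)
          have h5 : dInt (q * y - q * a) = q * |y - a| := by
            have : |q * y - q * a| = q * |y - a| := by
              rw [← mul_sub, abs_mul, abs_of_pos hp]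
            rw [dInt_eq (by rw [this]; exact e1.le), this]
          have : δ ≤ dInt (q * y) - δ := by linarith
          gcongr
  intro hF
  obtain ⟨a, ha, hj⟩ := main m
  obtain ⟨j, hjm, hle⟩ := hF ha
  have h1 := hj j hjm
  have h2 : (0 : ℝ) < (n : ℝ) ^ (j + 1) * δ := by positivity
  have h3 : (0 : ℝ) < (n : ℝ) ^ m := by positivity
  nlinarith

lemma full (n : ℕ) (hn : 1 < n) (δ : ℝ) (hδ : 0 < δ) :
    ∀ᵐ x ∂(volume.restrict (Set.Ioc (0 : ℝ) 1)), ∃ j : ℕ, dInt ((n : ℝ) ^ (j + 1) * x) ≤ δ := by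
  have herg := AddCircle.ergodic_nsmul (T := 1) hn
  let U : Set UnitAddCircle := ⋃ j : ℕ, {x | ‖(n ^ (j + 1)) • x‖ < δ}
  have hopen : ∀ j : ℕ, IsOpen {x : UnitAddCircle | ‖(n ^ (j + 1)) • x‖ < δ} := fun j =>
    isOpen_lt (continuous_norm.comp (continuous_nsmul _)) continuous_const
  have hU : IsOpen U := isOpen_iUnion hopen
  have hsub : (fun y : UnitAddCircle => n • y) ⁻¹' U ⊆ U := by
    intro x hx
    obtain ⟨j, hj⟩ := Set.mem_iUnion.mp hx
    refine Set.mem_iUnion.mpr ⟨j + 1, ?_⟩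
    simp only [Set.mem_setOf_eq] at hj ⊢
    rwa [← mul_nsmul', ← pow_succ] at hj
  have hfull : U =ᵐ[volume] Set.univ := by
    rcases herg.ae_empty_or_univ_of_preimage_ae_le hU.measurableSet.nullMeasurableSet
      (Filter.Eventually.of_forall hsub) with h0 | h1
    · exfalso
      have h2 : volume U = 0 := by rw [measure_congr h0]; simp
      have h3 : (0 : UnitAddCircle) ∈ U := Set.mem_iUnion.mpr ⟨0, by simpa using hδ⟩
      exact (hU.measure_pos volume ⟨0, h3⟩).ne' h2
    · exact h1
  have hae : ∀ᵐ x : UnitAddCircle, x ∈ U := by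
    filter_upwards [hfull] with x hx
    have : (x ∈ U) = (x ∈ Set.univ) := hx
    rw [this]; trivial
  have hmp := UnitAddCircle.measurePreserving_mk 0
  rw [zero_add] at hmp
  filter_upwards [hmp.quasiMeasurePreserving.ae hae] with x hx
  obtain ⟨j, hj⟩ := Set.mem_iUnion.mp hx
  refine ⟨j, ?_⟩
  simp only [Set.mem_setOf_eq] at hj
  unfold dInt
  rw [← AddCircle.coe_nsmul, nsmul_eq_mul] at hj
  push_cast at hj
  exact hj.le

lemma choose_m (n : ℕ) (hn : 1 < n) (δ : ℝ) (hδ : 0 < δ) (ε : ENNReal) (hε : 0 < ε) :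
    ∃ m : ℕ, (volume.restrict (Set.Ioc (0 : ℝ) 1)) (blockSet n m δ)ᶜ < ε := by
  have hanti : Antitone fun m : ℕ => (blockSet n m δ)ᶜ := by
    intro a b hab
    apply Set.compl_subset_compl.mpr
    rintro x ⟨j, hj, hx⟩
    exact ⟨j, hj.trans_le hab, hx⟩
  have ht := tendsto_measure_iInter_atTop (μ := volume.restrict (Set.Ioc (0 : ℝ) 1))
    (fun m => (blockSet_closed n m δ).measurableSet.compl.nullMeasurableSet) hanti
    ⟨0, measure_ne_top _ _⟩
  have h0 : (volume.restrict (Set.Ioc (0 : ℝ) 1)) (⋂ m : ℕ, (blockSet n m δ)ᶜ) = 0 := by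
    refine measure_mono_null ?_ (ae_iff.mp (full n hn δ hδ))
    intro x hx
    rintro ⟨j, hj⟩
    exact Set.mem_iInter.mp hx (j + 1) ⟨j, Nat.lt_succ_self j, hj⟩
  rw [h0] at ht
  exact (ht.eventually (gt_mem_nhds hε)).exists

/-- There exists a compact HNUP set `W̃ ⊆ ℝ` with `H¹(W̃) > 0` (hence `dim_H W̃ = 1`). -/
theorem stmt17 :
    ∃ W : Set ℝ, IsCompact W ∧ HNUP W ∧ 0 < μH[1] W ∧ dimH W = 1 := by
  obtain ⟨ε, hε, hsum⟩ := ENNReal.exists_pos_sum_of_countable' (one_ne_zero) ℕ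
  choose m hm using fun k : ℕ => choose_m (4 * (k + 1)) (by omega) (1 / ((k : ℝ) + 1))
    (by positivity) (ε k) (hε k)
  set B : ℕ → Set ℝ := fun k => blockSet (4 * (k + 1)) (m k) (1 / ((k : ℝ) + 1)) with hB
  have hBc : IsClosed (⋂ k, B k) := isClosed_iInter fun k => blockSet_closed _ _ _
  have hpos : 0 < volume (Set.Icc (0 : ℝ) 1 ∩ ⋂ k, B k) := by
    have h1 : (volume.restrict (Set.Ioc (0 : ℝ) 1)) (⋂ k, B k)ᶜ < 1 := by
      rw [Set.compl_iInter]
      refine lt_of_le_of_lt (measure_iUnion_le _) (lt_of_le_of_lt ?_ hsum)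
      exact ENNReal.tsum_le_tsum fun k => (hm k).le
    have h2 : (volume.restrict (Set.Ioc (0 : ℝ) 1)) (⋂ k, B k) ≠ 0 := by
      intro h0
      have h3 := measure_add_measure_compl (μ := volume.restrict (Set.Ioc (0 : ℝ) 1))
        hBc.measurableSet
      rw [h0, zero_add] at h3
      rw [h3] at h1
      simp at h1
    rw [Measure.restrict_apply hBc.measurableSet] at h2
    refine lt_of_lt_of_le (pos_iff_ne_zero.mpr h2) (measure_mono ?_)
    rintro x ⟨hx, hx'⟩
    exact ⟨Set.Ioc_subset_Icc_self hx', hx⟩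
  have hpos' : 0 < μH[1] (Set.Icc (0 : ℝ) 1 ∩ ⋂ k, B k) := by
    rw [hausdorffMeasure_real]; exact hpos
  refine ⟨Set.Icc (0 : ℝ) 1 ∩ ⋂ k, B k, isCompact_Icc.inter_right hBc, ?_, hpos', ?_⟩
  · rintro F hF ⟨hcomp, hnt, c, hc, h⟩
    have hd : 0 < Metric.diam F := Metric.diam_pos hnt hcomp.isBounded
    obtain ⟨k, hk⟩ := exists_nat_one_div_lt (lt_min hd (show 0 < c / 8 by positivity))
    have hk1 := hk.trans_le (min_le_left _ _)
    have hk2 := hk.trans_le (min_le_right _ _)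
    have hk0 : (0 : ℝ) ≤ k := Nat.cast_nonneg k
    refine key (4 * (k + 1)) (1 / ((k : ℝ) + 1)) (by positivity) ?_ ?_ (m k) F c (by linarith)
      hnt.nonempty ?_ h (fun x hx => Set.mem_iInter.mp (hF hx).2 k)
    · rw [div_le_one (by positivity)]; linarith
    · push_cast
      apply le_of_eq
      field_simp
    · refine lt_of_le_of_lt ?_ hk1
      push_cast
      apply one_div_le_one_div_of_le <;> linarith
  · apply le_antisymm
    · exact (dimH_mono (Set.subset_univ _)).trans Real.dimH_univ.le
    · have := le_dimH_of_hausdorffMeasure_ne_zero (d := 1)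
        (s := Set.Icc (0 : ℝ) 1 ∩ ⋂ k, B k) (by simpa using hpos'.ne')
      simpa using this
end

section
/- There exists a compact hereditarily non uniformly perfect set Ẽ ⊆ ℝ² with positive 2-dimensional Lebesgue measure, m_2(Ẽ) > 0 (hence dim_H Ẽ = 2). -/
open MeasureTheory Filter Metric

abbrev E2 := EuclideanSpace ℝ (Fin 2)

/-- The square lattice of mesh `s`. -/
def SqLat (s : ℝ) : Set E2 := {x | ∀ i, ∃ z : ℤ, x i = s * z}

lemma Lat_nonempty (s : ℝ) : (SqLat s).Nonempty :=
  ⟨0, fun i => ⟨0, by simp⟩⟩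

lemma Lat_cover {s : ℝ} (hs : 0 < s) (x : E2) : ∃ p ∈ SqLat s, dist x p ≤ s := by
  refine ⟨WithLp.toLp 2 (fun i => s * (round (x i / s) : ℤ)), fun i => ⟨_, rfl⟩, ?_⟩
  have key : ∀ i, (x i - s * (round (x i / s) : ℤ)) ^ 2 ≤ s ^ 2 / 4 := by
    intro i
    have h := abs_sub_round (x i / s)
    have h2 : x i - s * (round (x i / s) : ℤ) = s * (x i / s - (round (x i / s) : ℤ)) := by
      field_simp
    rw [h2, mul_pow]
    have h3 : (x i / s - (round (x i / s) : ℤ)) ^ 2 ≤ 1 / 4 := by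
      rw [← sq_abs]
      nlinarith [abs_nonneg (x i / s - (round (x i / s) : ℤ))]
    nlinarith [sq_nonneg s]
  rw [EuclideanSpace.dist_eq]
  apply Real.sqrt_le_iff.2 ⟨hs.le, ?_⟩
  simp only [Fin.sum_univ_two, Real.dist_eq, sq_abs]
  nlinarith [key 0, key 1, sq_nonneg s]

lemma Lat_sep {s : ℝ} (hs : 0 < s) {p q : E2} (hp : p ∈ SqLat s) (hq : q ∈ SqLat s) (hne : p ≠ q) :
    s ≤ dist p q := by
  have : ∃ i, p i ≠ q i := by
    by_contra! h
    exact hne (by ext i; exact h i)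
  obtain ⟨i, hi⟩ := this
  obtain ⟨a, ha⟩ := hp i
  obtain ⟨b, hb⟩ := hq i
  have hab : a ≠ b := by rintro rfl; exact hi (ha.trans hb.symm)
  have h1 : (1 : ℝ) ≤ |(a : ℝ) - b| := by
    have : 1 ≤ |a - b| := Int.one_le_abs (sub_ne_zero.2 hab)
    exact_mod_cast this
  have h2 : s ≤ |p i - q i| := by
    rw [ha, hb, ← mul_sub, abs_mul, abs_of_pos hs]
    nlinarith
  have h3 : ‖(p - q) i‖ ≤ ‖p - q‖ := PiLp.norm_apply_le (p - q) i
  rw [dist_eq_norm]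
  refine h2.trans ?_
  simpa [Real.norm_eq_abs] using h3

/-- Distance to the `j`-th lattice. -/
noncomputable def DD (ρ : ℝ) (j : ℕ) (x : E2) : ℝ := infDist x (SqLat (ρ ^ j))

lemma DD_cont (ρ : ℝ) (j : ℕ) : Continuous (DD ρ j) := continuous_infDist_pt _

/-- The points to be removed. -/
def WW (ρ : ℝ) (k n : ℕ) : Set E2 := {x | ∀ j, k ≤ j → j < k + n → ρ * ρ ^ j < DD ρ j x}

lemma WW_open (ρ : ℝ) (k n : ℕ) : IsOpen (WW ρ k n) := by
  have : WW ρ k n = ⋂ j ∈ Finset.Ico k (k + n), {x | ρ * ρ ^ j < DD ρ j x} := by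
    ext x; simp [WW]
  rw [this]
  exact isOpen_biInter_finset fun j _ => isOpen_lt continuous_const (DD_cont ρ j)

lemma WW_anti (ρ : ℝ) (k : ℕ) : Antitone (WW ρ k) := fun _ _ h _ hx j h1 h2 =>
  hx j h1 (by omega)

lemma WW_null {ρ : ℝ} (h0 : 0 < ρ) (h1 : ρ ≤ 1 / 12) (k : ℕ) :
    volume (⋂ n, WW ρ k n) = 0 := by
  set A := ⋂ n, WW ρ k n with hA
  have hAm : MeasurableSet A := MeasurableSet.iInter fun n => (WW_open ρ k n).measurableSet
  by_contra hne
  have hb := Besicovitch.ae_tendsto_measure_inter_div (volume : Measure E2) A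
  have hmem := ae_restrict_mem (μ := (volume : Measure E2)) hAm
  have hnb : NeBot (ae (volume.restrict A)) := by
    rw [ae_neBot]
    simpa [Measure.restrict_eq_zero] using hne
  obtain ⟨x, hx, hxA⟩ := (hb.and hmem).exists
  have hseq : Tendsto (fun j : ℕ => 2 * ρ ^ j) atTop (nhdsWithin 0 (Set.Ioi 0)) := by
    refine tendsto_nhdsWithin_iff.2 ⟨?_, Eventually.of_forall fun j => ?_⟩
    · simpa using (tendsto_pow_atTop_nhds_zero_of_lt_one h0.le (by linarith)).const_mul 2
    · exact Set.mem_Ioi.2 (by positivity)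
  have hlim := (hx.comp hseq).add_const (ENNReal.ofReal ((ρ / 2) ^ 2))
  have hle : ∀ᶠ j : ℕ in atTop,
      volume (A ∩ closedBall x (2 * ρ ^ j)) / volume (closedBall x (2 * ρ ^ j))
        + ENNReal.ofReal ((ρ / 2) ^ 2) ≤ 1 := by
    filter_upwards [eventually_ge_atTop k] with j hj
    have hs : 0 < ρ ^ j := pow_pos h0 j
    obtain ⟨p, hp, hxp⟩ := Lat_cover hs x
    have hBpos : volume (closedBall x (2 * ρ ^ j)) ≠ 0 :=
      (measure_closedBall_pos _ _ (by positivity)).ne'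
    have hBfin : volume (closedBall x (2 * ρ ^ j)) ≠ ⊤ := measure_closedBall_lt_top.ne
    have hb : volume (closedBall p (ρ * ρ ^ j))
        = ENNReal.ofReal ((ρ / 2) ^ 2) * volume (closedBall x (2 * ρ ^ j)) := by
      rw [Measure.addHaar_closedBall _ p (by positivity), Measure.addHaar_closedBall _ x (by positivity),
        ← mul_assoc, ← ENNReal.ofReal_mul (by positivity)]
      congr 2
      simp only [finrank_euclideanSpace, Fintype.card_fin]
      ring
    have hsub : closedBall p (ρ * ρ ^ j) ⊆ closedBall x (2 * ρ ^ j) := by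
      apply closedBall_subset_closedBall'
      rw [dist_comm]
      nlinarith
    have hdisj : Disjoint (A ∩ closedBall x (2 * ρ ^ j)) (closedBall p (ρ * ρ ^ j)) := by
      rw [Set.disjoint_left]
      rintro y ⟨hyA, -⟩ hyp
      have h := Set.mem_iInter.1 hyA (j + 1) j hj (by omega)
      have h' : DD ρ j y ≤ dist y p := infDist_le_dist_of_mem hp
      have := mem_closedBall.1 hyp
      linarith
    have hsum : volume (A ∩ closedBall x (2 * ρ ^ j)) + volume (closedBall p (ρ * ρ ^ j))
        ≤ volume (closedBall x (2 * ρ ^ j)) := by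
      rw [← measure_union hdisj measurableSet_closedBall]
      exact measure_mono (Set.union_subset Set.inter_subset_right hsub)
    rw [hb] at hsum
    calc _ = (volume (A ∩ closedBall x (2 * ρ ^ j)) +
            ENNReal.ofReal ((ρ / 2) ^ 2) * volume (closedBall x (2 * ρ ^ j))) /
              volume (closedBall x (2 * ρ ^ j)) := by
            rw [ENNReal.add_div, ENNReal.mul_div_cancel_right hBpos hBfin]
      _ ≤ 1 := ENNReal.div_le_of_le_mul (by simpa using hsum)
  have := le_of_tendsto hlim hle
  have hpos : 0 < ENNReal.ofReal ((ρ / 2) ^ 2) := ENNReal.ofReal_pos.2 (by positivity)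
  exact absurd this (not_le.2 (ENNReal.lt_add_right ENNReal.one_ne_top hpos.ne'))

lemma UP_meets {ρ c : ℝ} (h0 : 0 < ρ) (h1 : ρ ≤ 1 / 12) (hc : 12 * ρ ≤ c) {F : Set E2}
    (hF : F.Nonempty) {k : ℕ} (hk : ρ ^ k < diam F)
    (hup : ∀ a ∈ F, ∀ r : ℝ, 0 < r → r < diam F → ∃ y ∈ F, c * r < ‖y - a‖ ∧ ‖y - a‖ < r)
    (n : ℕ) :
    ∃ a ∈ F, ∀ j, k ≤ j → j < k + n → ρ * ρ ^ j + ρ ^ (k + n) < DD ρ j a := by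
  induction n with
  | zero => obtain ⟨a, ha⟩ := hF; exact ⟨a, ha, fun j _ _ => by omega⟩
  | succ n ih =>
    obtain ⟨a, ha, hj⟩ := ih
    set s := ρ ^ (k + n) with hs
    have hs0 : 0 < s := pow_pos h0 _
    have hs1 : ρ ^ (k + (n + 1)) = ρ * s := by rw [hs, ← add_assoc, pow_succ, mul_comm]
    have hsk : s ≤ ρ ^ k := pow_le_pow_of_le_one h0.le (by linarith) (by omega)
    have hρs : ρ * s ≤ 1 / 12 * s := by nlinarith
    have hρs0 : 0 < ρ * s := by positivity
    rw [hs1]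
    by_cases hD : 2 * (ρ * s) < DD ρ (k + n) a
    · refine ⟨a, ha, fun j h2 h3 => ?_⟩
      rcases Nat.lt_or_ge j (k + n) with h | h
      · linarith [hj j h2 h]
      · obtain rfl : j = k + n := by omega
        rw [← hs]; linarith
    · push Not at hD
      obtain ⟨y, hy, hy1, hy2⟩ := hup a ha (s / 2) (by positivity) (by linarith)
      rw [← dist_eq_norm] at hy1 hy2
      refine ⟨y, hy, fun j h2 h3 => ?_⟩
      rcases Nat.lt_or_ge j (k + n) with h | h
      · have h4 := hj j h2 h
        have h5 : DD ρ j a ≤ DD ρ j y + dist a y := infDist_le_infDist_add_dist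
        rw [dist_comm] at h5
        linarith
      · obtain rfl : j = k + n := by omega
        rw [← hs]
        have hlt : infDist a (SqLat s) < 3 * (ρ * s) := by
          have : infDist a (SqLat s) ≤ 2 * (ρ * s) := hD
          linarith
        obtain ⟨p, hp, hap⟩ := (infDist_lt_iff (Lat_nonempty s)).1 hlt
        have hge : 3 * (ρ * s) ≤ infDist y (SqLat s) := by
          rw [le_infDist (Lat_nonempty s)]
          intro q hq
          by_cases hqp : q = p
          · subst hqp
            have := dist_triangle y q a
            rw [dist_comm q a] at this
            nlinarith
          · have h6 := Lat_sep hs0 hp hq (Ne.symm hqp)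
            have h7 := dist_triangle4 p a y q
            rw [dist_comm p a, dist_comm a y] at h7
            linarith
        have : DD ρ (k + n) y = infDist y (SqLat s) := rfl
        linarith

lemma dimH_eq_two {E : Set E2} (h : 0 < volume E) : dimH E = 2 := by
  apply le_antisymm
  · refine (dimH_mono (Set.subset_univ E)).trans ?_
    rw [Real.dimH_univ_eq_finrank]; simp
  · have hh : Measure.IsAddHaarMeasure (Measure.hausdorffMeasure (2 : ℝ) : Measure E2) := by
      simpa using MeasureTheory.isAddHaarMeasure_hausdorffMeasure (E := E2)
    have heq := Measure.isAddLeftInvariant_eq_smul (volume : Measure E2)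
      (Measure.hausdorffMeasure (2 : ℝ))
    refine le_dimH_of_hausdorffMeasure_ne_zero (d := 2) ?_
    intro h0
    rw [heq] at h
    simp at h0
    simp [h0] at h

/-- There exists a compact HNUP set `Ẽ ⊆ ℝ²` with `m₂(Ẽ) > 0` (hence `dim_H Ẽ = 2`). -/
theorem stmt18 :
    ∃ E : Set (EuclideanSpace ℝ (Fin 2)), IsCompact E ∧ HNUP E ∧
      0 < volume E ∧ dimH E = 2 := by
  let ρ : ℕ → ℝ := fun m => 1 / ((m : ℝ) + 12)
  have hρ0 : ∀ m, 0 < ρ m := fun m => by positivity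
  have hρ1 : ∀ m, ρ m ≤ 1 / 12 := fun m => by
    apply one_div_le_one_div_of_le (by norm_num)
    linarith [(Nat.cast_nonneg m : (0 : ℝ) ≤ m)]
  let B : Set E2 := closedBall 0 1
  have hB : volume B ≠ 0 := (measure_closedBall_pos _ _ one_pos).ne'
  have hBf : volume B ≠ ⊤ := measure_closedBall_lt_top.ne
  obtain ⟨ε, hε, hεs⟩ := ENNReal.exists_pos_sum_of_countable' hB (ℕ × ℕ)
  have hex : ∀ i : ℕ × ℕ, ∃ n, volume (B ∩ WW (ρ i.1) i.2 n) ≤ ε i := by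
    intro i
    have ht := tendsto_measure_iInter_atTop (μ := (volume : Measure E2))
      (s := fun n => B ∩ WW (ρ i.1) i.2 n)
      (fun n => (measurableSet_closedBall.inter (WW_open _ _ n).measurableSet).nullMeasurableSet)
      (fun a b hab => Set.inter_subset_inter_right _ (WW_anti _ _ hab))
      ⟨0, ((measure_mono Set.inter_subset_left).trans_lt hBf.lt_top).ne⟩
    have h0 : volume (⋂ n, B ∩ WW (ρ i.1) i.2 n) = 0 :=
      measure_mono_null (Set.iInter_mono fun n => Set.inter_subset_right)
        (WW_null (hρ0 i.1) (hρ1 i.1) i.2)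
    rw [h0] at ht
    obtain ⟨n, hn⟩ := (ht.eventually_lt_const (hε i)).exists
    exact ⟨n, hn.le⟩
  choose N hN using hex
  let U : Set E2 := ⋃ i : ℕ × ℕ, WW (ρ i.1) i.2 (N i)
  have hUo : IsOpen U := isOpen_iUnion fun i => WW_open _ _ _
  have hvol : 0 < volume (B \ U) := by
    rw [pos_iff_ne_zero]
    intro h0
    have h1 : volume B ≤ volume (B ∩ U) + volume (B \ U) := measure_le_inter_add_sdiff _ _ _
    have h2 : volume (B ∩ U) ≤ ∑' i, ε i := by
      rw [Set.inter_iUnion]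
      exact (measure_iUnion_le _).trans (ENNReal.tsum_le_tsum hN)
    rw [h0, add_zero] at h1
    exact absurd (h1.trans h2) (not_le.2 hεs)
  refine ⟨B \ U, (isCompact_closedBall 0 1).diff hUo, ?_, hvol, dimH_eq_two hvol⟩
  rintro F hF ⟨hFc, hFn, c, hc, hup⟩
  obtain ⟨m, hm⟩ := exists_nat_ge (12 / c)
  have hmc : 12 * ρ m ≤ c := by
    change 12 * (1 / ((m : ℝ) + 12)) ≤ c
    rw [div_le_iff₀ hc] at hm
    rw [mul_one_div, div_le_iff₀ (by positivity)]
    nlinarith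
  have hd : 0 < diam F := Metric.diam_pos hFn hFc.isBounded
  obtain ⟨k, hk⟩ := exists_pow_lt_of_lt_one hd (show ρ m < 1 by linarith [hρ1 m])
  obtain ⟨a, ha, haj⟩ := UP_meets (hρ0 m) (hρ1 m) hmc hFn.nonempty hk hup (N (m, k))
  refine (hF ha).2 (Set.mem_iUnion.2 ⟨(m, k), fun j h1 h2 => ?_⟩)
  have := haj j h1 h2
  have : 0 < ρ m ^ (k + N (m, k)) := pow_pos (hρ0 m) _
  simp only at *
  linarith
end
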